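/- arXiv:2412.21075 — 3 statements merged into one kernel-verified Lean document; each statement's English description precedes it below -/
import Mathlib

section
/- Let A = (a_n) and B = (b_n) be Waterman sequences with B proper. The following are equivalent: (a) whenever K ⊆ ABV is bounded in the norm ‖·‖_{ABV} and relatively compact with respect to the supremum norm ‖·‖_∞, then K ⊆ BBV and K is relatively compact in the norm ‖·‖_{BBV}; (b) for every ε > 0 there exists k₀ ∈ ℕ such that for every nonincreasing sequence (c_n) of nonnegative real numbers with c_n → 0 and ∑_{n=1}^∞ a_n c_n < ∞, one has ∑_{n=k₀+1}^∞ b_n c_n ≤ ε · ∑_{n=1}^∞ a_n c_n. -/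
open Filter Set
open scoped ENNReal

/-- A Waterman sequence: a nonincreasing sequence of positive reals whose series diverges. -/
def IsWaterman (a : ℕ → ℝ) : Prop :=
  Antitone a ∧ (∀ n, 0 < a n) ∧ ¬ Summable a

/-- A Waterman sequence is proper if it moreover tends to zero. -/
def IsProperWaterman (a : ℕ → ℝ) : Prop :=
  IsWaterman a ∧ Tendsto a atTop (nhds 0)

/-- An admissible sequence of nonoverlapping closed subintervals `[s n, t n]` of `[0,1]`:
the intervals are contained in `[0,1]` and have pairwise disjoint interiors. -/
def Nonoverlapping (s t : ℕ → ℝ) : Prop :=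
  (∀ n, 0 ≤ s n ∧ s n ≤ t n ∧ t n ≤ 1) ∧
  Pairwise fun m n => Disjoint (Set.Ioo (s m) (t m)) (Set.Ioo (s n) (t n))

/-- The `A`-variation (in the sense of Waterman) of `x` on `[0,1]`, with values in `[0,∞]`. -/
noncomputable def eVar (a : ℕ → ℝ) (x : ℝ → ℝ) : ℝ≥0∞ :=
  ⨆ p : {p : (ℕ → ℝ) × (ℕ → ℝ) // Nonoverlapping p.1 p.2},
    ∑' n, ENNReal.ofReal (a n * |x (p.1.2 n) - x (p.1.1 n)|)

/-- Membership in the space `ABV` of functions of bounded `A`-variation. -/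
def MemABV (a : ℕ → ℝ) (x : ℝ → ℝ) : Prop := eVar a x < ⊤

/-- The norm `‖x‖_{ABV} = |x(0)| + var_A(x)`, with values in `[0,∞]`. -/
noncomputable def eNormABV (a : ℕ → ℝ) (x : ℝ → ℝ) : ℝ≥0∞ :=
  ENNReal.ofReal |x 0| + eVar a x

/-- The supremum norm of `x` on `[0,1]`, with values in `[0,∞]`. -/
noncomputable def eSupNorm (x : ℝ → ℝ) : ℝ≥0∞ :=
  ⨆ t ∈ Set.Icc (0 : ℝ) 1, ENNReal.ofReal |x t|

/-- `x` is bounded on `[0,1]`. -/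
def BoundedOn01 (x : ℝ → ℝ) : Prop := ∃ C : ℝ, ∀ t ∈ Set.Icc (0 : ℝ) 1, |x t| ≤ C

/-- `K` is relatively compact with respect to the supremum norm on `[0,1]`: every sequence
in `K` has a subsequence converging in the supremum norm to some bounded function. -/
def RelCompSup (K : Set (ℝ → ℝ)) : Prop :=
  ∀ u : ℕ → ℝ → ℝ, (∀ j, u j ∈ K) →
    ∃ φ : ℕ → ℕ, StrictMono φ ∧ ∃ x : ℝ → ℝ, BoundedOn01 x ∧
      Tendsto (fun k => eSupNorm (u (φ k) - x)) atTop (nhds 0)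

/-- `K` is relatively compact in the norm of the space `BBV` (for the sequence `b`):
every sequence in `K` has a subsequence converging in `‖·‖_{BBV}` to an element of `BBV`. -/
def RelCompABV (b : ℕ → ℝ) (K : Set (ℝ → ℝ)) : Prop :=
  ∀ u : ℕ → ℝ → ℝ, (∀ j, u j ∈ K) →
    ∃ φ : ℕ → ℕ, StrictMono φ ∧ ∃ x : ℝ → ℝ, MemABV b x ∧
      Tendsto (fun k => eNormABV b (u (φ k) - x)) atTop (nhds 0)

/-- `K` is a bounded subset of `ABV`. -/
def BddInABV (a : ℕ → ℝ) (K : Set (ℝ → ℝ)) : Prop :=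
  ∃ M : ℝ≥0∞, M < ⊤ ∧ ∀ x ∈ K, eNormABV a x ≤ M

/-- `∑_{k=1}^n b_k = o(∑_{k=1}^n a_k)`. -/
def PartialSumsLittleO (a b : ℕ → ℝ) : Prop :=
  Tendsto (fun n => (∑ k ∈ Finset.range n, b k) / (∑ k ∈ Finset.range n, a k))
    atTop (nhds 0)

/-- Condition (b): for every `ε > 0` there is `k₀` such that for every nonincreasing
nonnegative sequence `c` tending to `0` with `∑ aₙcₙ < ∞` one has
`∑_{n>k₀} bₙcₙ ≤ ε ∑ₙ aₙcₙ`. -/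
def SmallTailCond (a b : ℕ → ℝ) : Prop :=
  ∀ ε : ℝ, 0 < ε → ∃ k₀ : ℕ, ∀ c : ℕ → ℝ,
    (∀ n, 0 ≤ c n) → Antitone c → Tendsto c atTop (nhds 0) →
    (∑' n, ENNReal.ofReal (a n * c n)) < ⊤ →
    (∑' n, ENNReal.ofReal (b (n + k₀) * c (n + k₀))) ≤
      ENNReal.ofReal ε * ∑' n, ENNReal.ofReal (a n * c n)

/-- The compact-embedding property from `ABV` into `BBV`: every bounded subset of `ABV`
which is relatively compact in the supremum norm is contained in `BBV` and relatively
compact there. -/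
def CompactEmbeddingABV (a b : ℕ → ℝ) : Prop :=
  ∀ K : Set (ℝ → ℝ), (∀ x ∈ K, MemABV a x) → BddInABV a K → RelCompSup K →
    (∀ x ∈ K, MemABV b x) ∧ RelCompABV b K

/-- The summable ideal `I_A = {C ⊆ ℕ : ∑_{n ∈ C} a_n < ∞}` (as a family of sets;
it may equal `P(ℕ)` when `∑ a_n < ∞`). -/
def IdealOf (a : ℕ → ℝ) : Set (Set ℕ) := {C : Set ℕ | Summable fun n : C => a n}

/-- The Katětov order on families of subsets of `ℕ`. -/
def KatetovLE (I J : Set (Set ℕ)) : Prop :=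
  ∃ f : ℕ → ℕ, ∀ C ∈ I, f ⁻¹' C ∈ J

/-- Given a sequence `b` and an increasing sequence `m` of naturals, the sequence `b^M`,
whose `n`-th term is `k·bₙ` where `k` is the number of indices `j` with `m j ≤ n`
(and `bₙ` itself if `n` is below all of `m`). -/
def seqM (b : ℕ → ℝ) (m : ℕ → ℕ) (n : ℕ) : ℝ :=
  ((max 1 (((Finset.range (n + 1)).filter fun j => m j ≤ n).card) : ℕ) : ℝ) * b n

/-- An admissible `n`-tuple of nonoverlapping closed subintervals of `[0,1]`. -/
def NonoverlappingFin {n : ℕ} (s t : Fin n → ℝ) : Prop :=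
  (∀ i, 0 ≤ s i ∧ s i ≤ t i ∧ t i ≤ 1) ∧
  Pairwise fun i j => Disjoint (Set.Ioo (s i) (t i)) (Set.Ioo (s j) (t j))

/-- The modulus of variation of Chanturia: `v(x,n)` is the supremum of `∑_{k=1}^n |x(I_k)|`
over all `n`-tuples of nonoverlapping closed subintervals of `[0,1]`. -/
noncomputable def modVar (x : ℝ → ℝ) (n : ℕ) : ℝ≥0∞ :=
  ⨆ p : {p : (Fin n → ℝ) × (Fin n → ℝ) // NonoverlappingFin p.1 p.2},
    ENNReal.ofReal (∑ i, |x (p.1.2 i) - x (p.1.1 i)|)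

/-- Membership in the Chanturia class `V[g(n)]`: `x` is bounded and `v(x,n) = O(g(n))`. -/
def MemChanturia (g : ℕ → ℝ) (x : ℝ → ℝ) : Prop :=
  BoundedOn01 x ∧ ∃ η : ℝ, 0 < η ∧ ∀ n, modVar x n ≤ ENNReal.ofReal (η * g n)

/-- The norm `‖x‖_{φ_g} = |x(0)| + sup_n v(x,n)/g(n)` of the Chanturia class. -/
noncomputable def eNormChan (g : ℕ → ℝ) (x : ℝ → ℝ) : ℝ≥0∞ :=
  ENNReal.ofReal |x 0| + ⨆ n, modVar x n / ENNReal.ofReal (g n)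

/-- The family `𝒢`: positive, nondecreasing `g` tending to `∞` with `n/g(n)`
nondecreasing and tending to `∞`. -/
def MemG (g : ℕ → ℝ) : Prop :=
  (∀ n, 0 < g n) ∧ Monotone g ∧ Tendsto g atTop atTop ∧
  Monotone (fun n : ℕ => (n : ℝ) / g n) ∧ Tendsto (fun n : ℕ => (n : ℝ) / g n) atTop atTop

/-- `K` is a bounded subset of the Chanturia class `V[g(n)]`. -/
def BddInChan (g : ℕ → ℝ) (K : Set (ℝ → ℝ)) : Prop :=
  ∃ M : ℝ≥0∞, M < ⊤ ∧ ∀ x ∈ K, eNormChan g x ≤ M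

/-- `K` is relatively compact in the norm of the Chanturia class `V[h(n)]`. -/
def RelCompChan (h : ℕ → ℝ) (K : Set (ℝ → ℝ)) : Prop :=
  ∀ u : ℕ → ℝ → ℝ, (∀ j, u j ∈ K) →
    ∃ φ : ℕ → ℕ, StrictMono φ ∧ ∃ x : ℝ → ℝ, MemChanturia h x ∧
      Tendsto (fun k => eNormChan h (u (φ k) - x)) atTop (nhds 0)

/-- The compact-embedding property from `V[g(n)]` into `V[h(n)]`. -/
def CompactEmbeddingChan (g h : ℕ → ℝ) : Prop :=
  ∀ K : Set (ℝ → ℝ), (∀ x ∈ K, MemChanturia g x) → BddInChan g K → RelCompSup K →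
    (∀ x ∈ K, MemChanturia h x) ∧ RelCompChan h K

/-- The submeasure `φ_g(C) = sup_n |C ∩ {0,…,n}| / g(n)`, with values in `[0,∞]`. -/
noncomputable def phiSub (g : ℕ → ℝ) (C : Set ℕ) : ℝ≥0∞ :=
  ⨆ n, ENNReal.ofReal (((C ∩ Set.Iic n).ncard : ℝ) / g n)

/-- The exhaustive ideal `Exh(φ_g)`. -/
def Exh (g : ℕ → ℝ) : Set (Set ℕ) :=
  {C : Set ℕ | Tendsto (fun k => phiSub g (C \ Set.Iic k)) atTop (nhds 0)}

/-- The characteristic function of `[0,t]`. -/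
noncomputable def chi (t : ℝ) : ℝ → ℝ := Set.indicator (Set.Icc 0 t) fun _ => 1

theorem wt_le_eVar {a : ℕ → ℝ} {x : ℝ → ℝ} {s t : ℕ → ℝ} (h : Nonoverlapping s t) :
    ∑' n, ENNReal.ofReal (a n * |x (t n) - x (s n)|) ≤ eVar a x :=
  le_iSup (fun p : {p : (ℕ → ℝ) × (ℕ → ℝ) // Nonoverlapping p.1 p.2} =>
    ∑' n, ENNReal.ofReal (a n * |x (p.1.2 n) - x (p.1.1 n)|)) ⟨(s, t), h⟩

/-- Reindexing finitely many intervals. -/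
theorem wt_reindex {a : ℕ → ℝ} {x : ℝ → ℝ} {s t : ℕ → ℝ} (h : Nonoverlapping s t)
    {N : ℕ} (e : Fin N → ℕ) (he : Function.Injective e) :
    ∑' n, ENNReal.ofReal (a n * (if hn : n < N then |x (t (e ⟨n, hn⟩)) - x (s (e ⟨n, hn⟩))| else 0))
      ≤ eVar a x := by
  have h' : Nonoverlapping (fun n => if hn : n < N then s (e ⟨n, hn⟩) else 0)
      (fun n => if hn : n < N then t (e ⟨n, hn⟩) else 0) := by
    refine ⟨fun n => ?_, fun m n hmn => ?_⟩
    · by_cases hn : n < N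
      · simp only [hn, dif_pos]; exact h.1 _
      · simp [hn]
    · by_cases hn : n < N
      · by_cases hm : m < N
        · simp only [hn, hm, dif_pos]
          apply h.2
          intro h1
          apply hmn
          simpa using he h1
        · simp [hm]
      · simp [hn]
  refine le_trans (le_of_eq ?_) (wt_le_eVar h')
  refine tsum_congr fun n => ?_
  by_cases hn : n < N <;> simp [hn]

theorem wt_point {a : ℕ → ℝ} {x : ℝ → ℝ} {r : ℝ} (hr : r ∈ Set.Icc (0 : ℝ) 1) :
    ENNReal.ofReal (a 0 * |x r - x 0|) ≤ eVar a x := by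
  have h' : Nonoverlapping (fun _ => 0) (fun n => if n = 0 then r else 0) := by
    refine ⟨fun n => ?_, fun m n hmn => ?_⟩
    · by_cases hn : n = 0 <;> simp [hn, hr.1, hr.2]
    · by_cases hn : n = 0
      · have hm : m ≠ 0 := by omega
        simp [hm]
      · simp [hn]
  refine le_trans ?_ (wt_le_eVar h')
  refine le_trans (le_of_eq ?_) (ENNReal.le_tsum 0)
  simp

theorem wt_le_sup {x : ℝ → ℝ} {r : ℝ} (hr : r ∈ Set.Icc (0 : ℝ) 1) :
    ENNReal.ofReal |x r| ≤ eSupNorm x :=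
  le_iSup₂ (f := fun t (_ : t ∈ Set.Icc (0 : ℝ) 1) => ENNReal.ofReal |x t|) r hr

theorem wt_sub {a : ℕ → ℝ} (ha : ∀ n, 0 < a n) (x y : ℝ → ℝ) :
    eVar a (x - y) ≤ eVar a x + eVar a y := by
  refine iSup_le ?_
  rintro ⟨⟨s, t⟩, h⟩
  refine le_trans ?_ (add_le_add (wt_le_eVar h) (wt_le_eVar h))
  rw [← ENNReal.tsum_add]
  refine ENNReal.tsum_le_tsum fun n => ?_
  have := (ha n).le
  rw [← ENNReal.ofReal_add (by positivity) (by positivity), ← mul_add]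
  refine ENNReal.ofReal_le_ofReal (mul_le_mul_of_nonneg_left ?_ this)
  simp only [Pi.sub_apply]
  calc |x (t n) - y (t n) - (x (s n) - y (s n))|
      = |(x (t n) - x (s n)) - (y (t n) - y (s n))| := by congr 1; ring
    _ ≤ _ := abs_sub _ _

theorem wt_lsc {a : ℕ → ℝ} {u : ℕ → ℝ → ℝ} {x : ℝ → ℝ} {M : ℝ≥0∞}
    (hu : ∀ k, eVar a (u k) ≤ M)
    (hx : ∀ r ∈ Set.Icc (0 : ℝ) 1, Tendsto (fun k => u k r) atTop (nhds (x r))) :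
    eVar a x ≤ M := by
  refine iSup_le ?_
  rintro ⟨⟨s, t⟩, h⟩
  refine ENNReal.tsum_le_of_sum_range_le fun N => ?_
  have hs : ∀ n, s n ∈ Set.Icc (0 : ℝ) 1 := fun n =>
    ⟨(h.1 n).1, (h.1 n).2.1.trans (h.1 n).2.2⟩
  have ht : ∀ n, t n ∈ Set.Icc (0 : ℝ) 1 := fun n =>
    ⟨(h.1 n).1.trans (h.1 n).2.1, (h.1 n).2.2⟩
  have hT : Tendsto (fun k => ∑ n ∈ Finset.range N,
      ENNReal.ofReal (a n * |u k (t n) - u k (s n)|)) atTop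
      (nhds (∑ n ∈ Finset.range N, ENNReal.ofReal (a n * |x (t n) - x (s n)|))) := by
    refine tendsto_finsetSum _ fun n _ => ?_
    refine ENNReal.tendsto_ofReal (Tendsto.const_mul _ ?_)
    exact ((hx _ (ht n)).sub (hx _ (hs n))).abs
  exact le_of_tendsto' hT fun k =>
    (ENNReal.sum_le_tsum _).trans ((wt_le_eVar h).trans (hu k))

theorem wt_sort {N : ℕ} (v : Fin N → ℝ) :
    ∃ σ : Equiv.Perm (Fin N), ∀ i j, i ≤ j → v (σ j) ≤ v (σ i) := by
  refine ⟨Tuple.sort (fun i => - v i), fun i j hij => ?_⟩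
  have := Tuple.monotone_sort (fun i => - v i) hij
  exact neg_le_neg_iff.1 this

theorem wt_key {a b : ℕ → ℝ} (hb : Antitone b) (hb0 : ∀ n, 0 < b n) {ε : ℝ} {k₀ : ℕ}
    (hk : ∀ c : ℕ → ℝ,
      (∀ n, 0 ≤ c n) → Antitone c → Tendsto c atTop (nhds 0) →
      (∑' n, ENNReal.ofReal (a n * c n)) < ⊤ →
      (∑' n, ENNReal.ofReal (b (n + k₀) * c (n + k₀))) ≤
      ENNReal.ofReal ε * ∑' n, ENNReal.ofReal (a n * c n)) (x : ℝ → ℝ) :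
    eVar b x ≤ (∑ n ∈ Finset.range k₀, ENNReal.ofReal (b n)) * (2 * eSupNorm x) +
      ENNReal.ofReal ε * eVar a x := by
  refine iSup_le ?_
  rintro ⟨⟨s, t⟩, h⟩
  refine ENNReal.tsum_le_of_sum_range_le fun N => ?_
  have hs : ∀ n, s n ∈ Set.Icc (0 : ℝ) 1 := fun n =>
    ⟨(h.1 n).1, (h.1 n).2.1.trans (h.1 n).2.2⟩
  have ht : ∀ n, t n ∈ Set.Icc (0 : ℝ) 1 := fun n =>
    ⟨(h.1 n).1.trans (h.1 n).2.1, (h.1 n).2.2⟩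
  obtain ⟨v, hv⟩ : ∃ v : Fin N → ℝ, v = fun i : Fin N => |x (t i) - x (s i)| := ⟨_, rfl⟩
  obtain ⟨σ, hσ⟩ := wt_sort v
  obtain ⟨c, hcd⟩ : ∃ c : ℕ → ℝ, c = fun n => if hn : n < N then v (σ ⟨n, hn⟩) else 0 := ⟨_, rfl⟩
  have hv0 : ∀ i, 0 ≤ v i := fun i => by rw [hv]; exact abs_nonneg _
  have hc0 : ∀ n, 0 ≤ c n := fun n => by
    by_cases hn : n < N
    · simp only [hcd, hn, dif_pos]; exact hv0 _
    · simp [hcd, hn]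
  have hcN : ∀ n, N ≤ n → c n = 0 := fun n hn => by simp [hcd, not_lt.2 hn]
  have hca : Antitone c := by
    intro m n hmn
    by_cases hn : n < N
    · have hm : m < N := by omega
      simp only [hcd, hn, hm, dif_pos]
      exact hσ _ _ hmn
    · rw [hcN n (by omega)]; exact hc0 m
  have hct : Tendsto c atTop (nhds 0) :=
    tendsto_const_nhds.congr' ((eventually_ge_atTop N).mono fun n hn => (hcN n hn).symm)
  have hfin : (∑' n, ENNReal.ofReal (a n * c n)) < ⊤ := by
    rw [tsum_eq_sum (s := Finset.range N)]
    · exact ENNReal.sum_lt_top.2 fun _ _ => ENNReal.ofReal_lt_top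
    · intro n hn
      rw [hcN n (by simpa using hn)]; simp
  have h1 := hk c hc0 hca hct hfin
  have h2 : (∑' n, ENNReal.ofReal (a n * c n)) ≤ eVar a x := by
    rw [hcd, hv]
    exact wt_reindex h (fun i : Fin N => (σ i : ℕ))
      (fun i j hij => σ.injective (Fin.ext hij))
  have h3 : ∑ n ∈ Finset.range N, b n * |x (t n) - x (s n)| ≤
      ∑ n ∈ Finset.range N, b n * c n := by
    rw [← Fin.sum_univ_eq_sum_range (fun n => b n * |x (t n) - x (s n)|),
      ← Fin.sum_univ_eq_sum_range (fun n => b n * c n)]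
    have hm : Monovary (fun i : Fin N => b i) (fun i => v (σ i)) := by
      intro i j hij
      refine hb ?_
      by_contra hlt
      exact absurd (hσ i j (not_le.1 hlt).le) (not_le.2 hij)
    have := hm.sum_mul_comp_perm_le_sum_mul (σ := σ⁻¹)
    simpa [hcd, hv] using this
  have h4 : ∑ n ∈ Finset.range N, ENNReal.ofReal (b n * |x (t n) - x (s n)|) ≤
      ∑' n, ENNReal.ofReal (b n * c n) := by
    refine le_trans ?_ (ENNReal.sum_le_tsum (Finset.range N))
    rw [← ENNReal.ofReal_sum_of_nonneg, ← ENNReal.ofReal_sum_of_nonneg]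
    · exact ENNReal.ofReal_le_ofReal h3
    · exact fun n _ => mul_nonneg (hb0 n).le (hc0 n)
    · exact fun n _ => mul_nonneg (hb0 n).le (abs_nonneg _)
  refine h4.trans ?_
  have h5 : ∑' n, ENNReal.ofReal (b n * c n) =
      ∑ n ∈ Finset.range k₀, ENNReal.ofReal (b n * c n) +
      ∑' n, ENNReal.ofReal (b (n + k₀) * c (n + k₀)) :=
    (ENNReal.summable.sum_add_tsum_nat_add' (f := fun n => ENNReal.ofReal (b n * c n))).symm
  rw [h5]
  refine add_le_add ?_ (h1.trans (by gcongr))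
  rw [Finset.sum_mul]
  refine Finset.sum_le_sum fun n _ => ?_
  rw [ENNReal.ofReal_mul (hb0 n).le]
  gcongr
  by_cases hn : n < N
  · simp only [hcd, hn, dif_pos, hv]
    refine (ENNReal.ofReal_le_ofReal (abs_sub _ _)).trans ?_
    rw [ENNReal.ofReal_add (abs_nonneg _) (abs_nonneg _), two_mul]
    exact add_le_add (wt_le_sup (ht _)) (wt_le_sup (hs _))
  · rw [hcN n (by omega)]; simp

theorem wt_sup_lt_top {a : ℕ → ℝ} (ha : ∀ n, 0 < a n) {x : ℝ → ℝ} (hx : eVar a x < ⊤) :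
    eSupNorm x < ⊤ := by
  have : eSupNorm x ≤ ENNReal.ofReal |x 0| + eVar a x / ENNReal.ofReal (a 0) := by
    refine iSup₂_le fun r hr => ?_
    have h1 := wt_point (a := a) (x := x) hr
    rw [ENNReal.ofReal_mul (ha 0).le, mul_comm] at h1
    have h2 : ENNReal.ofReal |x r - x 0| ≤ eVar a x / ENNReal.ofReal (a 0) := by
      rw [ENNReal.le_div_iff_mul_le]
      · exact h1
      · left; simpa using ha 0
      · left; simp
    refine le_trans ?_ (add_le_add le_rfl h2)
    rw [← ENNReal.ofReal_add (abs_nonneg _) (abs_nonneg _)]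
    refine ENNReal.ofReal_le_ofReal ?_
    have := abs_add_le (x 0) (x r - x 0)
    simpa using this
  refine this.trans_lt (ENNReal.add_lt_top.2 ⟨ENNReal.ofReal_lt_top, ?_⟩)
  exact ENNReal.div_lt_top hx.ne (by simpa using ha 0)

theorem wt_pointwise {u : ℕ → ℝ → ℝ} {x : ℝ → ℝ}
    (h : Tendsto (fun k => eSupNorm (u k - x)) atTop (nhds 0)) :
    ∀ r ∈ Set.Icc (0 : ℝ) 1, Tendsto (fun k => u k r) atTop (nhds (x r)) := by
  intro r hr
  rw [tendsto_iff_edist_tendsto_0]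
  refine tendsto_of_tendsto_of_tendsto_of_le_of_le tendsto_const_nhds h (fun _ => zero_le)
    fun k => ?_
  refine le_trans (le_of_eq ?_) (wt_le_sup hr)
  rw [edist_dist, Real.dist_eq]; rfl

theorem wt_suff {a b : ℕ → ℝ} (hA : IsWaterman a) (hB : IsWaterman b)
    (h : SmallTailCond a b) : CompactEmbeddingABV a b := by
  obtain ⟨haa, ha0, -⟩ := hA
  obtain ⟨hba, hb0, -⟩ := hB
  have hmem : ∀ x, MemABV a x → MemABV b x := by
    intro x hx
    obtain ⟨k₀, hk⟩ := h 1 one_pos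
    refine (wt_key hba hb0 hk x).trans_lt (ENNReal.add_lt_top.2 ⟨?_, ?_⟩)
    · refine ENNReal.mul_lt_top (ENNReal.sum_lt_top.2 fun _ _ => ENNReal.ofReal_lt_top) ?_
      exact ENNReal.mul_lt_top (by simp) (wt_sup_lt_top ha0 hx)
    · exact ENNReal.mul_lt_top ENNReal.ofReal_lt_top hx
  intro K hK hbd hsup
  refine ⟨fun x hx => hmem x (hK x hx), ?_⟩
  intro u hu
  obtain ⟨M, hM, hKM⟩ := hbd
  obtain ⟨φ, hφ, x, -, hlim⟩ := hsup u hu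
  have huM : ∀ k, eVar a (u (φ k)) ≤ M := fun k =>
    le_trans (by simp [eNormABV]) (hKM _ (hu (φ k)))
  have hxM : eVar a x ≤ M := wt_lsc huM (wt_pointwise hlim)
  refine ⟨φ, hφ, x, hmem x (hxM.trans_lt hM), ?_⟩
  rw [ENNReal.tendsto_nhds_zero]
  intro δ hδ
  have hδ2 : δ / 2 ≠ 0 := (ENNReal.half_pos hδ.ne').ne'
  obtain ⟨ε, hε, hεM⟩ := ENNReal.exists_nnreal_pos_mul_lt (a := M + M)
    (ENNReal.add_lt_top.2 ⟨hM, hM⟩).ne hδ2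
  obtain ⟨k₀, hk⟩ := h ε (by exact_mod_cast hε)
  set B0 := ∑ n ∈ Finset.range k₀, ENNReal.ofReal (b n) with hB0
  have hB0t : B0 ≠ ⊤ := (ENNReal.sum_lt_top.2 fun _ _ => ENNReal.ofReal_lt_top).ne
  have hT : Tendsto (fun k => eSupNorm (u (φ k) - x) + B0 * (2 * eSupNorm (u (φ k) - x)))
      atTop (nhds 0) := by
    have h1 := ENNReal.Tendsto.const_mul (a := 2) hlim (Or.inr (by simp))
    have h2 := ENNReal.Tendsto.const_mul (a := B0) h1 (Or.inr hB0t)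
    simpa using hlim.add h2
  have hev := ENNReal.tendsto_nhds_zero.1 hT (δ / 2) (pos_iff_ne_zero.2 hδ2)
  filter_upwards [hev] with k hkk
  calc eNormABV b (u (φ k) - x) ≤ eSupNorm (u (φ k) - x) +
        (B0 * (2 * eSupNorm (u (φ k) - x)) + ENNReal.ofReal ε * (M + M)) := by
        refine add_le_add (wt_le_sup (by simp)) ?_
        refine (wt_key hba hb0 hk _).trans ?_
        gcongr
        exact (wt_sub ha0 _ _).trans (add_le_add (huM k) hxM)
    _ ≤ δ / 2 + δ / 2 := by
        rw [← add_assoc]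
        refine add_le_add hkk ?_
        simpa using hεM.le
    _ = δ := ENNReal.add_halves δ

/-- Abel summation comparison. -/
theorem wt_abel {a d e : ℕ → ℝ} (ha : Antitone a) (ha0 : ∀ n, 0 < a n)
    (h : ∀ m, ∑ n ∈ Finset.range m, d n ≤ ∑ n ∈ Finset.range m, e n) (N : ℕ) :
    ∑ n ∈ Finset.range N, a n * d n ≤ ∑ n ∈ Finset.range N, a n * e n := by
  have key : a N * (∑ n ∈ Finset.range N, e n - ∑ n ∈ Finset.range N, d n) ≤
      ∑ n ∈ Finset.range N, a n * e n - ∑ n ∈ Finset.range N, a n * d n := by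
    induction N with
    | zero => simp
    | succ N ih =>
      have h1 := h (N + 1)
      have h2 : a (N + 1) * (∑ n ∈ Finset.range (N + 1), e n - ∑ n ∈ Finset.range (N + 1), d n)
          ≤ a N * (∑ n ∈ Finset.range (N + 1), e n - ∑ n ∈ Finset.range (N + 1), d n) :=
        mul_le_mul_of_nonneg_right (ha (Nat.le_succ N)) (by linarith)
      simp only [Finset.sum_range_succ] at *
      nlinarith
  have := mul_nonneg (ha0 N).le (sub_nonneg.2 (h N))
  linarith

theorem wt_sum_le_range {c : ℕ → ℝ} (hc : Antitone c) (F : Finset ℕ) :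
    ∑ i ∈ F, c i ≤ ∑ i ∈ Finset.range F.card, c i := by
  induction F using Finset.induction_on_max with
  | empty => simp
  | insert m F hm ih =>
    have hmF : m ∉ F := fun h => lt_irrefl _ (hm m h)
    have hcard : F.card ≤ m := by
      have : F ⊆ Finset.range m := fun i hi => Finset.mem_range.2 (hm i hi)
      simpa using Finset.card_le_card this
    rw [Finset.sum_insert hmF, Finset.card_insert_of_notMem hmF, Finset.sum_range_succ]
    have := hc hcard
    linarith

/-- Rearrangement inequality along a partial injection. -/
theorem wt_rearr {a c d : ℕ → ℝ} (ha : Antitone a) (ha0 : ∀ n, 0 < a n)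
    (hc : Antitone c) (hc0 : ∀ n, 0 ≤ c n) (S : Set ℕ) (σ : ℕ → ℕ) (hσ : Set.InjOn σ S)
    (hd : ∀ n ∈ S, d n = c (σ n)) (hd' : ∀ n ∉ S, d n = 0) (N : ℕ) :
    ∑ n ∈ Finset.range N, a n * d n ≤ ∑ n ∈ Finset.range N, a n * c n := by
  classical
  refine wt_abel ha ha0 (fun m => ?_) N
  have h1 : ∑ n ∈ Finset.range m, d n = ∑ n ∈ (Finset.range m).filter (· ∈ S), c (σ n) := by
    rw [Finset.sum_filter]
    refine Finset.sum_congr rfl fun n _ => ?_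
    split_ifs with h
    · exact hd n h
    · exact hd' n h
  have hinj : Set.InjOn σ ((Finset.range m).filter (· ∈ S) : Finset ℕ) := by
    intro i hi j hj hij
    simp only [Finset.coe_filter, Set.mem_ofPred_eq] at hi hj
    exact hσ hi.2 hj.2 hij
  rw [h1, ← Finset.sum_image (f := c) hinj]
  refine (wt_sum_le_range hc _).trans ?_
  refine Finset.sum_le_sum_of_subset_of_nonneg ?_ fun i _ _ => hc0 i
  intro i hi
  rw [Finset.mem_range] at *
  refine hi.trans_le (Finset.card_image_le.trans ((Finset.card_filter_le _ _).trans ?_))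
  simp

/-- Location of the spikes. -/
noncomputable def wtP (n : ℕ) : ℝ := 1 / (2 * (n : ℝ) + 2)

theorem wtP_inj : Function.Injective wtP := by
  intro m n h
  unfold wtP at h
  have h1 : (2 * (m : ℝ) + 2) ≠ 0 := by positivity
  have h2 : (2 * (n : ℝ) + 2) ≠ 0 := by positivity
  field_simp at h
  have : (m : ℝ) = n := by linarith
  exact_mod_cast this

/-- Spike function with heights `c n`. -/
noncomputable def wtX (c : ℕ → ℝ) : ℝ → ℝ := Function.extend wtP c 0

theorem wtX_P (c : ℕ → ℝ) (n : ℕ) : wtX c (wtP n) = c n := wtP_inj.extend_apply _ _ _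

theorem wtX_not (c : ℕ → ℝ) (r : ℝ) (h : ¬ ∃ n, wtP n = r) : wtX c r = 0 :=
  Function.extend_apply' _ _ _ h

theorem wtX_nonneg {c : ℕ → ℝ} (hc0 : ∀ n, 0 ≤ c n) (r : ℝ) : 0 ≤ wtX c r := by
  by_cases h : ∃ n, wtP n = r
  · obtain ⟨n, rfl⟩ := h
    rw [wtX_P]; exact hc0 n
  · rw [wtX_not c r h]

theorem wtX_le {c : ℕ → ℝ} (hc0 : ∀ n, 0 ≤ c n) (hc : Antitone c) (r : ℝ) : wtX c r ≤ c 0 := by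
  by_cases h : ∃ n, wtP n = r
  · obtain ⟨n, rfl⟩ := h
    rw [wtX_P]; exact hc (Nat.zero_le n)
  · rw [wtX_not c r h]; exact hc0 0

theorem wtX_zero (c : ℕ → ℝ) : wtX c 0 = 0 := by
  apply wtX_not
  rintro ⟨n, hn⟩
  have : 0 < wtP n := by unfold wtP; positivity
  linarith

theorem wtX_var_ge {b c : ℕ → ℝ} (hc0 : ∀ n, 0 ≤ c n) :
    ∑' n, ENNReal.ofReal (b n * c n) ≤ eVar b (wtX c) := by
  have hN : Nonoverlapping wtP (fun n => 1 / (2 * (n : ℝ) + 1)) := by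
    refine ⟨fun n => ⟨by unfold wtP; positivity, ?_, ?_⟩, ?_⟩
    · unfold wtP
      exact one_div_le_one_div_of_le (by positivity) (by linarith)
    · rw [div_le_one (by positivity)]
      have : (0 : ℝ) ≤ n := by positivity
      linarith
    · have key : ∀ m n : ℕ, m < n → Disjoint (Set.Ioo (wtP m) (1 / (2 * (m : ℝ) + 1)))
          (Set.Ioo (wtP n) (1 / (2 * (n : ℝ) + 1))) := by
        intro m n hmn
        rw [Set.disjoint_left]
        intro r h1 h2
        have h3 : 1 / (2 * (n : ℝ) + 1) ≤ wtP m := by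
          unfold wtP
          refine one_div_le_one_div_of_le (by positivity) ?_
          have : (m : ℝ) + 1 ≤ n := by exact_mod_cast hmn
          linarith
        linarith [h1.1, h2.2]
      intro m n hmn
      rcases lt_or_gt_of_ne hmn with h | h
      · exact key m n h
      · exact (key n m h).symm
  refine le_trans (le_of_eq ?_) (wt_le_eVar hN)
  refine tsum_congr fun n => ?_
  have h1 : wtX c (1 / (2 * (n : ℝ) + 1)) = 0 := by
    apply wtX_not
    rintro ⟨m, hm⟩
    unfold wtP at hm
    have h1 : (2 * (m : ℝ) + 2) ≠ 0 := by positivity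
    have h2 : (2 * (n : ℝ) + 1) ≠ 0 := by positivity
    rw [div_eq_div_iff h1 h2] at hm
    have : 2 * n + 1 = 2 * m + 2 := by
      have : (2 * (n : ℝ) + 1) = 2 * m + 2 := by linarith
      exact_mod_cast this
    omega
  rw [h1, wtX_P, zero_sub, abs_neg, abs_of_nonneg (hc0 n)]

theorem wt_ends {a c : ℕ → ℝ} (ha : Antitone a) (ha0 : ∀ n, 0 < a n)
    (hc : Antitone c) (hc0 : ∀ n, 0 ≤ c n) (D : Set ℕ) (s : ℕ → ℝ) (hs : Set.InjOn s D) :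
    ∑' n, ENNReal.ofReal (a n * D.indicator (fun n => wtX c (s n)) n) ≤
      ∑' n, ENNReal.ofReal (a n * c n) := by
  classical
  refine ENNReal.tsum_le_of_sum_range_le fun N => ?_
  refine le_trans ?_ (ENNReal.sum_le_tsum (Finset.range N))
  have hnn : ∀ n, 0 ≤ D.indicator (fun n => wtX c (s n)) n := fun n =>
    Set.indicator_nonneg (fun n _ => wtX_nonneg hc0 _) n
  rw [← ENNReal.ofReal_sum_of_nonneg (fun n _ => mul_nonneg (ha0 n).le (hnn n)),
    ← ENNReal.ofReal_sum_of_nonneg (fun n _ => mul_nonneg (ha0 n).le (hc0 n))]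
  refine ENNReal.ofReal_le_ofReal ?_
  have hex : ∀ n, ∃ m, (∃ m, wtP m = s n) → wtP m = s n := fun n => by
    by_cases h : ∃ m, wtP m = s n
    · exact ⟨h.choose, fun _ => h.choose_spec⟩
    · exact ⟨0, fun h' => absurd h' h⟩
  choose σ hσ using hex
  refine wt_rearr ha ha0 hc hc0 {n | n ∈ D ∧ ∃ m, wtP m = s n} σ ?_ ?_ ?_ N
  · rintro i ⟨hi, hi'⟩ j ⟨hj, hj'⟩ hij
    apply hs hi hj
    rw [← hσ i hi', ← hσ j hj', hij]
  · rintro n ⟨hn, hn'⟩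
    rw [Set.indicator_of_mem hn, ← hσ n hn', wtX_P]
  · intro n hn
    by_cases hD : n ∈ D
    · rw [Set.indicator_of_mem hD]
      exact wtX_not _ _ fun h => hn ⟨hD, h⟩
    · exact Set.indicator_of_notMem hD _

theorem wtX_var_le {a c : ℕ → ℝ} (ha : Antitone a) (ha0 : ∀ n, 0 < a n)
    (hc : Antitone c) (hc0 : ∀ n, 0 ≤ c n) :
    eVar a (wtX c) ≤ ∑' n, ENNReal.ofReal (a n * c n) + ∑' n, ENNReal.ofReal (a n * c n) := by
  refine iSup_le ?_
  rintro ⟨⟨s, t⟩, h⟩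
  have hsi : Set.InjOn s {n | s n < t n} := by
    intro i hi j hj hij
    by_contra hne
    have hd : Disjoint (Set.Ioo (s i) (t i)) (Set.Ioo (s j) (t j)) := h.2 hne
    simp only [Set.mem_ofPred_eq] at hi hj
    rw [Set.Ioo_disjoint_Ioo] at hd
    simp only [hij, max_self] at hd hi
    exact absurd hd (not_le.2 (lt_min hi hj))
  have hti : Set.InjOn t {n | s n < t n} := by
    intro i hi j hj hij
    by_contra hne
    have hd : Disjoint (Set.Ioo (s i) (t i)) (Set.Ioo (s j) (t j)) := h.2 hne
    simp only [Set.mem_ofPred_eq] at hi hj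
    rw [Set.Ioo_disjoint_Ioo] at hd
    simp only [hij, min_self] at hd hi
    exact absurd hd (not_le.2 (max_lt hi hj))
  refine le_trans ?_ (add_le_add (wt_ends ha ha0 hc hc0 _ s hsi) (wt_ends ha ha0 hc hc0 _ t hti))
  rw [← ENNReal.tsum_add]
  refine ENNReal.tsum_le_tsum fun n => ?_
  show ENNReal.ofReal (a n * |wtX c (t n) - wtX c (s n)|) ≤ _
  by_cases hn : s n < t n
  · rw [Set.indicator_of_mem (by exact hn), Set.indicator_of_mem (by exact hn)]
    have h1 := wtX_nonneg hc0 (s n)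
    have h2 := wtX_nonneg hc0 (t n)
    have h3 := (ha0 n).le
    rw [← ENNReal.ofReal_add (by positivity) (by positivity), ← mul_add]
    refine ENNReal.ofReal_le_ofReal (mul_le_mul_of_nonneg_left ?_ h3)
    rw [abs_le]; constructor <;> linarith
  · have : s n = t n := le_antisymm (h.1 n).2.1 (not_lt.1 hn)
    rw [this]; simp

/-- Normalised bad sequences. -/
theorem wt_bad {a b : ℕ → ℝ} (ha0 : ∀ n, 0 < a n) {ε : ℝ} {k : ℕ} {c : ℕ → ℝ}
    (hc0 : ∀ n, 0 ≤ c n) (hc : Antitone c)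
    (hfin : (∑' n, ENNReal.ofReal (a n * c n)) < ⊤)
    (hbad : ENNReal.ofReal ε * ∑' n, ENNReal.ofReal (a n * c n) <
      ∑' n, ENNReal.ofReal (b (n + k) * c (n + k))) :
    ∃ d : ℕ → ℝ, (∀ n, 0 ≤ d n) ∧ Antitone d ∧ (∑' n, ENNReal.ofReal (a n * d n)) ≤ 1 ∧
      ENNReal.ofReal ε ≤ ∑' n, ENNReal.ofReal (b n * d n) ∧
      d 0 * ∑ n ∈ Finset.range k, a n ≤ 1 := by
  obtain ⟨S, hS⟩ : ∃ S, S = ∑' n, ENNReal.ofReal (a n * c n) := ⟨_, rfl⟩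
  rw [← hS] at hfin hbad
  have hS0 : S ≠ 0 := by
    intro h0
    rw [h0] at hS
    have hz := ENNReal.tsum_eq_zero.1 hS.symm
    have hc00 : ∀ n, c n = 0 := fun n => by
      have h1 := ENNReal.ofReal_eq_zero.1 (hz n)
      have h2 : a n * c n = 0 := le_antisymm h1 (mul_nonneg (ha0 n).le (hc0 n))
      exact (mul_eq_zero.1 h2).resolve_left (ha0 n).ne'
    simp [hc00] at hbad
  have hSr : 0 < S.toReal := ENNReal.toReal_pos hS0 hfin.ne
  have hof : ENNReal.ofReal (S.toReal)⁻¹ = S⁻¹ := by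
    rw [ENNReal.ofReal_inv_of_pos hSr, ENNReal.ofReal_toReal hfin.ne]
  have hd0 : ∀ n, 0 ≤ c (max n k) * (S.toReal)⁻¹ := fun n =>
    mul_nonneg (hc0 _) (inv_nonneg.2 hSr.le)
  have hsum : (∑' n, ENNReal.ofReal (a n * (c (max n k) * (S.toReal)⁻¹))) ≤ 1 := by
    calc (∑' n, ENNReal.ofReal (a n * (c (max n k) * (S.toReal)⁻¹)))
        ≤ ∑' n, ENNReal.ofReal (a n * c n) * S⁻¹ := by
          refine ENNReal.tsum_le_tsum fun n => ?_
          rw [← mul_assoc, ENNReal.ofReal_mul (mul_nonneg (ha0 n).le (hc0 _)), hof]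
          gcongr
          · exact (ha0 n).le
          · exact hc (le_max_left n k)
      _ = S * S⁻¹ := by rw [ENNReal.tsum_mul_right, ← hS]
      _ = 1 := ENNReal.mul_inv_cancel hS0 hfin.ne
  refine ⟨fun n => c (max n k) * (S.toReal)⁻¹, hd0, ?_, hsum, ?_, ?_⟩
  · intro m n hmn
    exact mul_le_mul_of_nonneg_right (hc (max_le_max_right k hmn)) (inv_nonneg.2 hSr.le)
  · have h1 : ENNReal.ofReal ε ≤ (∑' n, ENNReal.ofReal (b (n + k) * c (n + k))) * S⁻¹ := by
      rw [← div_eq_mul_inv, ENNReal.le_div_iff_mul_le (Or.inl hS0) (Or.inl hfin.ne)]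
      exact hbad.le
    refine h1.trans ?_
    rw [← ENNReal.tsum_mul_right]
    calc ∑' n, ENNReal.ofReal (b (n + k) * c (n + k)) * S⁻¹
        = ∑' n, ENNReal.ofReal (b (n + k) * (c (max (n + k) k) * (S.toReal)⁻¹)) := by
          refine tsum_congr fun n => ?_
          rw [max_eq_left (Nat.le_add_left k n), ← mul_assoc,
            ENNReal.ofReal_mul' (inv_nonneg.2 hSr.le), hof]
      _ ≤ _ := ENNReal.tsum_comp_le_tsum_of_injective (add_left_injective k)
          (fun n => ENNReal.ofReal (b n * (c (max n k) * (S.toReal)⁻¹)))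
  · have h1 := (ENNReal.sum_le_tsum (Finset.range k)).trans hsum
    rw [← ENNReal.ofReal_sum_of_nonneg (fun n _ => mul_nonneg (ha0 n).le (hd0 n)),
      ENNReal.ofReal_le_one] at h1
    refine le_trans (le_of_eq ?_) h1
    rw [Finset.mul_sum]
    refine Finset.sum_congr rfl fun n hn => ?_
    have : n < k := Finset.mem_range.1 hn
    simp only [max_eq_right this.le, max_eq_right (Nat.zero_le k)]
    ring

theorem wt_nec {a b : ℕ → ℝ} (hA : IsWaterman a) (hB : IsWaterman b)
    (h : CompactEmbeddingABV a b) : SmallTailCond a b := by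
  obtain ⟨haa, ha0, has⟩ := hA
  obtain ⟨hba, hb0, -⟩ := hB
  by_contra hcon
  unfold SmallTailCond at hcon
  push Not at hcon
  obtain ⟨ε, hε, hcon⟩ := hcon
  have hbad : ∀ k : ℕ, ∃ d : ℕ → ℝ, (∀ n, 0 ≤ d n) ∧ Antitone d ∧
      (∑' n, ENNReal.ofReal (a n * d n)) ≤ 1 ∧
      ENNReal.ofReal ε ≤ ∑' n, ENNReal.ofReal (b n * d n) ∧
      d 0 * ∑ n ∈ Finset.range k, a n ≤ 1 := fun k => by
    obtain ⟨c, hc0, hc, -, hfin, hb⟩ := hcon k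
    exact wt_bad ha0 hc0 hc hfin hb
  choose d hd0 hd hda hdb hdk using hbad
  have hat : Tendsto (fun k => ∑ n ∈ Finset.range k, a n) atTop atTop :=
    (not_summable_iff_tendsto_nat_atTop_of_nonneg fun n => (ha0 n).le).1 has
  have hd0t : Tendsto (fun k => d k 0) atTop (nhds 0) := by
    refine tendsto_of_tendsto_of_tendsto_of_le_of_le' tendsto_const_nhds
      (tendsto_inv_atTop_zero.comp hat) (Eventually.of_forall fun k => hd0 k 0) ?_
    filter_upwards [hat.eventually_gt_atTop 0] with k hk
    simp only [Function.comp]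
    rw [← one_div, le_div_iff₀ hk]
    exact hdk k
  have hvar : ∀ k, eVar a (wtX (d k)) ≤ 2 := fun k => by
    refine (wtX_var_le haa ha0 (hd k) (hd0 k)).trans ?_
    refine (add_le_add (hda k) (hda k)).trans (le_of_eq ?_)
    norm_num
  have hsupb : ∀ k, eSupNorm (wtX (d k)) ≤ ENNReal.ofReal (d k 0) := fun k => by
    refine iSup₂_le fun r _ => ENNReal.ofReal_le_ofReal ?_
    rw [abs_of_nonneg (wtX_nonneg (hd0 k) r)]
    exact wtX_le (hd0 k) (hd k) r
  have hsup : Tendsto (fun k => eSupNorm (wtX (d k))) atTop (nhds 0) := by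
    have := ENNReal.tendsto_ofReal hd0t
    rw [ENNReal.ofReal_zero] at this
    exact tendsto_of_tendsto_of_tendsto_of_le_of_le tendsto_const_nhds this (fun _ => zero_le) hsupb
  have hK := h (Set.range fun k => wtX (d k)) ?_ ?_ ?_
  · obtain ⟨φ, hφ, x, -, hx⟩ := hK.2 (fun k => wtX (d k)) (fun k => ⟨k, rfl⟩)
    have hv : Tendsto (fun k => eVar b (wtX (d (φ k)) - x)) atTop (nhds 0) :=
      tendsto_of_tendsto_of_tendsto_of_le_of_le tendsto_const_nhds hx (fun _ => zero_le)
        fun k => by simp [eNormABV]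
    have hx0 : x 0 = 0 := by
      have h1 : ENNReal.ofReal |x 0| ≤ 0 := by
        refine ge_of_tendsto' hx fun k => ?_
        simp [eNormABV, wtX_zero]
      simpa using h1
    have hxr : ∀ r ∈ Set.Icc (0 : ℝ) 1, x r = 0 := by
      intro r hr
      have h1 : Tendsto (fun k => b 0 * |wtX (d (φ k)) r - x r|) atTop (nhds 0) := by
        have h2 : Tendsto (fun k => ENNReal.ofReal (b 0 * |wtX (d (φ k)) r - x r|))
            atTop (nhds 0) := by
          refine tendsto_of_tendsto_of_tendsto_of_le_of_le tendsto_const_nhds hv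
            (fun _ => zero_le) fun k => ?_
          refine le_trans (le_of_eq ?_) (wt_point hr)
          simp [wtX_zero, hx0]
        have h3 := (ENNReal.tendsto_toReal ENNReal.zero_ne_top).comp h2
        refine h3.congr fun k => ?_
        exact ENNReal.toReal_ofReal (mul_nonneg (hb0 0).le (abs_nonneg _))
      have h4 : Tendsto (fun k => wtX (d (φ k)) r) atTop (nhds 0) := by
        have := wt_pointwise (x := 0) (u := fun k => wtX (d k)) (by simpa using hsup) r hr
        exact this.comp hφ.tendsto_atTop
      have h5 : Tendsto (fun k => b 0 * |wtX (d (φ k)) r - x r|) atTop (nhds (b 0 * |0 - x r|)) :=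
        ((h4.sub_const _).abs).const_mul _
      have h6 := tendsto_nhds_unique h1 h5
      have h7 := (mul_eq_zero.1 h6.symm).resolve_left (hb0 0).ne'
      simpa using h7
    have hge : ∀ k, ENNReal.ofReal ε ≤ eVar b (wtX (d (φ k)) - x) := by
      intro k
      refine ((hdb (φ k)).trans (wtX_var_ge (hd0 _))).trans ?_
      refine iSup_le ?_
      rintro ⟨⟨s, t⟩, hst⟩
      refine le_trans (le_of_eq ?_) (wt_le_eVar hst)
      refine tsum_congr fun n => ?_
      have h1 := hxr (s n) ⟨(hst.1 n).1, (hst.1 n).2.1.trans (hst.1 n).2.2⟩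
      have h2 := hxr (t n) ⟨(hst.1 n).1.trans (hst.1 n).2.1, (hst.1 n).2.2⟩
      simp [h1, h2]
    have := ge_of_tendsto' hv hge
    simp at this
    linarith
  · rintro _ ⟨k, rfl⟩
    exact (hvar k).trans_lt (by simp)
  · refine ⟨2, by simp, ?_⟩
    rintro _ ⟨k, rfl⟩
    simpa [eNormABV, wtX_zero] using hvar k
  · intro u hu
    choose κ hκ using hu
    simp only at hκ
    by_cases hfr : ∃ n, ∃ᶠ j in atTop, κ j = n
    · obtain ⟨n, hn⟩ := hfr
      obtain ⟨φ, hφ, hφn⟩ := extraction_of_frequently_atTop hn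
      refine ⟨φ, hφ, wtX (d n), ⟨d n 0, fun r _ => ?_⟩, ?_⟩
      · rw [abs_of_nonneg (wtX_nonneg (hd0 n) r)]
        exact wtX_le (hd0 n) (hd n) r
      · refine tendsto_const_nhds.congr fun k => ?_
        rw [← hκ, hφn]
        simp [eSupNorm]
    · push Not at hfr
      have hκt : Tendsto κ atTop atTop := by
        rw [tendsto_atTop]
        intro N
        have : ∀ᶠ j in atTop, ∀ n ∈ Finset.range N, κ j ≠ n := by
          rw [Filter.eventually_all_finset]
          exact fun n _ => hfr n
        filter_upwards [this] with j hj
        by_contra hlt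
        exact hj (κ j) (Finset.mem_range.2 (not_le.1 hlt)) rfl
      refine ⟨id, strictMono_id, 0, ⟨0, by simp⟩, ?_⟩
      refine (hsup.comp hκt).congr fun k => ?_
      simp [hκ]


/-- For Waterman sequences `A`, `B` with `B` proper, the compact-embedding
property of `ABV` into `BBV` is equivalent to the small-tail condition. -/
theorem stmt2 (a b : ℕ → ℝ) (hA : IsWaterman a) (hB : IsProperWaterman b) :
    CompactEmbeddingABV a b ↔ SmallTailCond a b := by
  exact ⟨wt_nec hA hB.1, wt_suff hA hB.1⟩
end

section
/- Let A = (a_n) and B = (b_n) be Waterman sequences with B proper. The following are equivalent: (a) whenever K ⊆ ABV is bounded in the norm ‖·‖_{ABV} and relatively compact with respect to the supremum norm ‖·‖_∞, then K ⊆ BBV and K is relatively compact in the norm ‖·‖_{BBV}; (b) I_A ≤_K I_{B^M} for some increasing sequence M = (m_k) of natural numbers; (c) ∑_{k=1}^n b_k = o(∑_{k=1}^n a_k), i.e. lim_{n→∞} (∑_{k=1}^n b_k)/(∑_{k=1}^n a_k) = 0. -/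
open Filter Set
open scoped ENNReal

/-! ### Elementary sums -/

lemma psum_mono {a : ℕ → ℝ} (h : ∀ n, 0 < a n) : Monotone fun n => ∑ k ∈ Finset.range n, a k := by
  intro m n hmn
  exact Finset.sum_le_sum_of_subset_of_nonneg (Finset.range_mono hmn) fun i _ _ => (h i).le

lemma psum_pos {a : ℕ → ℝ} (h : ∀ n, 0 < a n) {n : ℕ} (hn : 0 < n) :
    0 < ∑ k ∈ Finset.range n, a k :=
  Finset.sum_pos (fun i _ => h i) (Finset.nonempty_range_iff.2 hn.ne')

lemma psum_tendsto {a : ℕ → ℝ} (hA : IsWaterman a) :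
    Tendsto (fun n => ∑ k ∈ Finset.range n, a k) atTop atTop :=
  (not_summable_iff_tendsto_nat_atTop_of_nonneg fun n => (hA.2.1 n).le).1 hA.2.2

lemma abel_bound (g d : ℕ → ℝ) (P : ℝ) (hP : 0 ≤ P)
    (hG : ∀ n, ∑ k ∈ Finset.range n, g k ≤ P) (hd : Antitone d) (hd0 : ∀ n, 0 ≤ d n) (N : ℕ) :
    ∑ n ∈ Finset.range N, g n * d n ≤ P * d 0 := by
  have key : ∀ N, ∑ n ∈ Finset.range (N+1), g n * d n ≤
      (∑ k ∈ Finset.range (N+1), g k) * d N + P * (d 0 - d N) := by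
    intro N
    induction N with
    | zero => simp
    | succ N ih =>
      rw [Finset.sum_range_succ, Finset.sum_range_succ g]
      have h1 := hG (N+1)
      have h2 := hd (Nat.le_succ N)
      simp only [Nat.succ_eq_add_one] at h2
      nlinarith [mul_nonneg (sub_nonneg.2 h1) (sub_nonneg.2 h2)]
  cases N with
  | zero => simpa using mul_nonneg hP (hd0 0)
  | succ N =>
    have := key N
    nlinarith [mul_le_mul_of_nonneg_right (hG (N+1)) (hd0 N)]

lemma fin_bound (a b d : ℕ → ℝ) (ha : ∀ n, 0 < a n) (hb : ∀ n, 0 < b n) {ε : ℝ} (hε : 0 < ε) {k0 : ℕ}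
    (h : ∀ n ≥ k0, ∑ k ∈ Finset.range n, b k ≤ ε * ∑ k ∈ Finset.range n, a k)
    (hd : Antitone d) (hd0 : ∀ n, 0 ≤ d n) (N : ℕ) :
    ∑ n ∈ Finset.range N, b n * d n ≤ (∑ k ∈ Finset.range k0, b k) * d 0 +
      ε * ∑ n ∈ Finset.range N, a n * d n := by
  have := abel_bound (fun n => b n - ε * a n) d (∑ k ∈ Finset.range k0, b k)
    (Finset.sum_nonneg fun i _ => (hb i).le) (by
      intro n
      rw [Finset.sum_sub_distrib, ← Finset.mul_sum]
      have hBn : 0 ≤ ∑ k ∈ Finset.range k0, b k := Finset.sum_nonneg fun i _ => (hb i).le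
      rcases le_total k0 n with hn | hn
      · linarith [h n hn]
      · have h1 := psum_mono hb hn
        have h2 : 0 ≤ ε * ∑ k ∈ Finset.range n, a k :=
          mul_nonneg hε.le (Finset.sum_nonneg fun i _ => (ha i).le)
        simp only at h1
        linarith) hd hd0 N
  simp only [sub_mul, Finset.sum_sub_distrib] at this
  rw [Finset.mul_sum]
  simp only [← mul_assoc]
  linarith

lemma sum_le_psum {a : ℕ → ℝ} (ha : Antitone a) (h0 : ∀ n, 0 < a n) (n : ℕ) :
    ∀ S : Finset ℕ, S.card ≤ n → ∑ k ∈ S, a k ≤ ∑ k ∈ Finset.range n, a k := by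
  induction n with
  | zero => intro S hS; simp [Finset.card_eq_zero.1 (Nat.le_zero.1 hS)]
  | succ n ih =>
    intro S hS
    rcases S.eq_empty_or_nonempty with rfl | hne
    · simpa using Finset.sum_nonneg fun i _ => (h0 i).le
    by_cases hc : S.card ≤ n
    · exact (ih S hc).trans (psum_mono h0 (Nat.le_succ n))
    have hc' : S.card = n + 1 := by omega
    have hm := S.max'_mem hne
    have hmax : n ≤ S.max' hne := by
      by_contra hlt
      have : S ⊆ Finset.range n := fun i hi => by
        have := S.le_max' i hi
        simp; omega
      have := Finset.card_le_card this
      simp at this; omega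
    rw [← Finset.sum_erase_add S a hm, Finset.sum_range_succ]
    exact add_le_add (ih _ (by rw [Finset.card_erase_of_mem hm]; omega)) (ha hmax)

lemma psum_two_mul {a : ℕ → ℝ} (ha : Antitone a) (n : ℕ) :
    ∑ k ∈ Finset.range (2 * n), a k ≤ 2 * ∑ k ∈ Finset.range n, a k := by
  rw [two_mul, Finset.sum_range_add, two_mul]
  gcongr with i _
  exact ha (by omega)

/-! ### Variation -/

lemma le_eVar (a : ℕ → ℝ) (x : ℝ → ℝ) {s t : ℕ → ℝ} (h : Nonoverlapping s t) :
    ∑' n, ENNReal.ofReal (a n * |x (t n) - x (s n)|) ≤ eVar a x :=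
  le_iSup (fun p : {p : (ℕ → ℝ) × (ℕ → ℝ) // Nonoverlapping p.1 p.2} =>
    ∑' n, ENNReal.ofReal (a n * |x (p.1.2 n) - x (p.1.1 n)|)) ⟨(s, t), h⟩

lemma eVar_le (a : ℕ → ℝ) (ha : ∀ n, 0 < a n) (x : ℝ → ℝ) (M : ℝ≥0∞)
    (h : ∀ s t, Nonoverlapping s t → ∀ N,
      ENNReal.ofReal (∑ n ∈ Finset.range N, a n * |x (t n) - x (s n)|) ≤ M) : eVar a x ≤ M := by
  refine iSup_le fun p => ?_
  rw [ENNReal.tsum_eq_iSup_nat]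
  refine iSup_le fun N => ?_
  rw [← ENNReal.ofReal_sum_of_nonneg fun i _ => mul_nonneg (ha i).le (abs_nonneg _)]
  exact h _ _ p.2 N

lemma fin_le_eVar (a : ℕ → ℝ) (ha : ∀ n, 0 < a n) (x : ℝ → ℝ) {s t : ℕ → ℝ}
    (h : Nonoverlapping s t) (N : ℕ) :
    ENNReal.ofReal (∑ n ∈ Finset.range N, a n * |x (t n) - x (s n)|) ≤ eVar a x := by
  rw [ENNReal.ofReal_sum_of_nonneg fun i _ => mul_nonneg (ha i).le (abs_nonneg _)]
  exact (ENNReal.sum_le_tsum _).trans (le_eVar a x h)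

lemma point_le_eVar (a : ℕ → ℝ) (ha : ∀ n, 0 < a n) (x : ℝ → ℝ) {r : ℝ} (hr : r ∈ Icc (0:ℝ) 1) :
    ENNReal.ofReal (a 0 * |x r - x 0|) ≤ eVar a x := by
  have := fin_le_eVar a ha x (s := fun _ => 0) (t := fun n => if n = 0 then r else 0)
    ⟨fun n => by by_cases h : n = 0 <;> simp [h, hr.1, hr.2], fun m n hmn => by
      by_cases h : n = 0
      · have : m ≠ 0 := fun h' => hmn (h'.trans h.symm)
        simp [this]
      · simp [h]⟩ 1
  simpa using this

lemma eVar_bdd {a : ℕ → ℝ} (ha : ∀ n, 0 < a n) {x : ℝ → ℝ} (h : eVar a x < ⊤) : BoundedOn01 x := by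
  refine ⟨|x 0| + (eVar a x).toReal / a 0, fun r hr => ?_⟩
  have h1 := point_le_eVar a ha x hr
  have h2 := (ENNReal.ofReal_le_iff_le_toReal h.ne).1 h1
  have h3 : |x r - x 0| ≤ (eVar a x).toReal / a 0 := by
    rw [le_div_iff₀ (ha 0)]; linarith
  have := abs_sub_abs_le_abs_sub (x r) (x 0)
  linarith

lemma eVar_sub_le (a : ℕ → ℝ) (ha : ∀ n, 0 < a n) (x y : ℝ → ℝ) :
    eVar a (x - y) ≤ eVar a x + eVar a y := by
  refine iSup_le fun p => ?_
  refine le_trans ?_ (add_le_add (le_eVar a x p.2) (le_eVar a y p.2))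
  rw [← ENNReal.tsum_add]
  refine ENNReal.tsum_le_tsum fun n => ?_
  rw [← ENNReal.ofReal_add (by have := ha n; positivity) (by have := ha n; positivity), ← mul_add]
  refine ENNReal.ofReal_le_ofReal (mul_le_mul_of_nonneg_left ?_ (ha n).le)
  simp only [Pi.sub_apply]
  have := abs_sub (x (p.1.2 n) - x (p.1.1 n)) (y (p.1.2 n) - y (p.1.1 n))
  rwa [show x (p.1.2 n) - x (p.1.1 n) - (y (p.1.2 n) - y (p.1.1 n)) =
    x (p.1.2 n) - y (p.1.2 n) - (x (p.1.1 n) - y (p.1.1 n)) by ring] at this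

lemma eVar_lsc (a : ℕ → ℝ) (ha : ∀ n, 0 < a n) (u : ℕ → ℝ → ℝ) (x : ℝ → ℝ) (M : ℝ≥0∞)
    (hu : ∀ k, eVar a (u k) ≤ M)
    (hx : ∀ r ∈ Icc (0:ℝ) 1, Tendsto (fun k => u k r) atTop (nhds (x r))) : eVar a x ≤ M := by
  refine eVar_le a ha x M fun s t hst N => ?_
  have ht : Tendsto (fun k => ENNReal.ofReal (∑ n ∈ Finset.range N, a n * |u k (t n) - u k (s n)|))
      atTop (nhds (ENNReal.ofReal (∑ n ∈ Finset.range N, a n * |x (t n) - x (s n)|))) := by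
    refine ENNReal.tendsto_ofReal (tendsto_finsetSum _ fun n _ => ?_)
    have h := hst.1 n
    exact ((((hx (t n) ⟨by linarith, h.2.2⟩).sub (hx (s n) ⟨h.1, by linarith⟩)).abs).const_mul _)
  exact le_of_tendsto' ht fun k => (fin_le_eVar a ha _ hst N).trans (hu k)

lemma exists_sort (N : ℕ) (e : Fin N → ℝ) : ∃ σ : Equiv.Perm (Fin N), Antitone (e ∘ σ) := by
  refine ⟨Tuple.sort (fun i => - e i), fun i j hij => ?_⟩
  have := Tuple.monotone_sort (fun i => - e i) hij
  simp only [Function.comp] at this ⊢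
  linarith

lemma key_bound (a b : ℕ → ℝ) (ha : ∀ n, 0 < a n) (hb : ∀ n, 0 < b n) (hbm : Antitone b)
    {ε : ℝ} (hε : 0 < ε) {k0 : ℕ}
    (h : ∀ n ≥ k0, ∑ k ∈ Finset.range n, b k ≤ ε * ∑ k ∈ Finset.range n, a k)
    (y : ℝ → ℝ) (S : ℝ) (hS0 : 0 ≤ S) (hS : ∀ r ∈ Icc (0:ℝ) 1, |y r| ≤ S) :
    eVar b y ≤ ENNReal.ofReal ((∑ k ∈ Finset.range k0, b k) * (2 * S)) +
      ENNReal.ofReal ε * eVar a y := by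
  refine eVar_le b hb y _ fun s t hst N => ?_
  obtain ⟨σ, hσ⟩ := exists_sort N (fun i => |y (t i) - y (s i)|)
  set s' : ℕ → ℝ := fun n => if hn : n < N then s (σ ⟨n, hn⟩) else 0 with hs'
  set t' : ℕ → ℝ := fun n => if hn : n < N then t (σ ⟨n, hn⟩) else 0 with ht'
  have hst' : Nonoverlapping s' t' := by
    constructor
    · intro n
      by_cases hn : n < N
      · simpa [hs', ht', hn] using hst.1 _
      · simp [hs', ht', hn]
    · intro m n hmn
      by_cases hn : n < N
      · by_cases hm : m < N
        · simp only [hs', ht', hn, hm, dif_pos]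
          refine hst.2 fun he => hmn ?_
          have := σ.injective (Fin.ext he)
          simpa using this
        · simp [hs', ht', hm]
      · simp [hs', ht', hn]
  set d : ℕ → ℝ := fun n => |y (t' n) - y (s' n)| with hd
  have hd0 : ∀ n, 0 ≤ d n := fun n => abs_nonneg _
  have hdN : ∀ n (hn : n < N), d n = |y (t (σ ⟨n, hn⟩)) - y (s (σ ⟨n, hn⟩))| := fun n hn => by
    simp [hd, hs', ht', hn]
  have hda : Antitone d := by
    intro m n hmn
    by_cases hn : n < N
    · have hm : m < N := by omega
      rw [hdN n hn, hdN m hm]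
      exact hσ (show (⟨m, hm⟩ : Fin N) ≤ ⟨n, hn⟩ from hmn)
    · have : d n = 0 := by simp [hd, hs', ht', hn]
      rw [this]; exact hd0 m
  have hd0S : d 0 ≤ 2 * S := by
    have h1 := hst'.1 0
    have h2 := hS (t' 0) ⟨by linarith, h1.2.2⟩
    have h3 := hS (s' 0) ⟨h1.1, by linarith⟩
    have := abs_sub (y (t' 0)) (y (s' 0))
    simp only [hd]; linarith
  have hre : ∑ n ∈ Finset.range N, b n * |y (t n) - y (s n)| ≤ ∑ n ∈ Finset.range N, b n * d n := by
    rw [Finset.sum_range, Finset.sum_range]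
    have hmv : Monovary (fun i : Fin N => b i) ((fun i : Fin N => |y (t i) - y (s i)|) ∘ σ) := by
      refine Antitone.monovary (fun i j hij => hbm hij) hσ
    have := hmv.sum_mul_comp_perm_le_sum_mul (σ := σ⁻¹)
    simp only [Function.comp, ← Equiv.Perm.mul_apply, mul_inv_cancel, Equiv.Perm.one_apply] at this
    refine this.trans (le_of_eq ?_)
    refine Finset.sum_congr rfl fun i _ => ?_
    rw [hdN i i.2]
  have hfb := fin_bound a b d ha hb hε h hda hd0 N
  have hB : 0 ≤ ∑ k ∈ Finset.range k0, b k := Finset.sum_nonneg fun i _ => (hb i).le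
  have hA : 0 ≤ ∑ n ∈ Finset.range N, a n * d n :=
    Finset.sum_nonneg fun i _ => mul_nonneg (ha i).le (hd0 i)
  calc ENNReal.ofReal (∑ n ∈ Finset.range N, b n * |y (t n) - y (s n)|)
      ≤ ENNReal.ofReal ((∑ k ∈ Finset.range k0, b k) * (2 * S) +
          ε * ∑ n ∈ Finset.range N, a n * d n) := by
        refine ENNReal.ofReal_le_ofReal (hre.trans (hfb.trans ?_))
        gcongr
    _ = ENNReal.ofReal ((∑ k ∈ Finset.range k0, b k) * (2 * S)) +
          ENNReal.ofReal ε * ENNReal.ofReal (∑ n ∈ Finset.range N, a n * d n) := by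
        rw [ENNReal.ofReal_add (by positivity) (by positivity), ENNReal.ofReal_mul hε.le]
    _ ≤ _ := by
        gcongr
        exact fin_le_eVar a ha y hst' N

lemma littleO_eps {a b : ℕ → ℝ} (ha : ∀ n, 0 < a n) (h : PartialSumsLittleO a b) {ε : ℝ}
    (hε : 0 < ε) : ∃ k0 : ℕ, 
    ∀ n ≥ k0, ∑ k ∈ Finset.range n, b k ≤ ε * ∑ k ∈ Finset.range n, a k := by
  have := (h.eventually (gt_mem_nhds hε))
  obtain ⟨k0, hk0⟩ := eventually_atTop.1 this
  refine ⟨k0, fun n hn => ?_⟩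
  rcases Nat.eq_zero_or_pos n with rfl | hpos
  · simp
  have h1 := hk0 n hn
  rw [div_lt_iff₀ (psum_pos ha hpos)] at h1
  exact h1.le

lemma abs_le_eSup (x : ℝ → ℝ) {r : ℝ} (hr : r ∈ Icc (0:ℝ) 1) : ENNReal.ofReal |x r| ≤ eSupNorm x :=
  le_iSup₂ (f := fun t (_ : t ∈ Icc (0:ℝ) 1) => ENNReal.ofReal |x t|) r hr

lemma eSup_lt_top {x : ℝ → ℝ} (h : BoundedOn01 x) : eSupNorm x < ⊤ := by
  obtain ⟨C, hC⟩ := h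
  exact lt_of_le_of_lt (iSup₂_le fun r hr => ENNReal.ofReal_le_ofReal (hC r hr)) ENNReal.ofReal_lt_top

lemma c_imp_mem {a b : ℕ → ℝ} (hA : IsWaterman a) (hB : IsWaterman b) (h : PartialSumsLittleO a b)
    {x : ℝ → ℝ} (hx : MemABV a x) : MemABV b x := by
  obtain ⟨k0, hk⟩ := littleO_eps hA.2.1 h one_pos
  obtain ⟨C, hC⟩ := eVar_bdd hA.2.1 hx
  refine lt_of_le_of_lt (key_bound a b hA.2.1 hB.2.1 hB.1 one_pos hk x C
    ((abs_nonneg _).trans (hC 0 (by simp))) hC) ?_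
  exact ENNReal.add_lt_top.2 ⟨ENNReal.ofReal_lt_top, ENNReal.mul_lt_top ENNReal.ofReal_lt_top hx⟩

lemma tendsto_pt {v : ℕ → ℝ → ℝ} {x : ℝ → ℝ} 
    (h : Tendsto (fun k => eSupNorm (v k - x)) atTop (nhds 0)) {r : ℝ} (hr : r ∈ Icc (0:ℝ) 1) :
    Tendsto (fun k => v k r) atTop (nhds (x r)) := by
  have h1 : Tendsto (fun k => ENNReal.ofReal |(v k - x) r|) atTop (nhds 0) :=
    tendsto_of_tendsto_of_tendsto_of_le_of_le tendsto_const_nhds h (fun _ => zero_le)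
      fun k => abs_le_eSup _ hr
  have h2 := (ENNReal.tendsto_toReal ENNReal.zero_ne_top).comp h1
  simp only [Function.comp_def, Pi.sub_apply, ENNReal.toReal_ofReal (abs_nonneg _),
    ENNReal.toReal_zero] at h2
  rw [tendsto_iff_dist_tendsto_zero]
  simpa [Real.dist_eq] using h2

lemma exists_eps {P η : ℝ≥0∞} (hP : P < ⊤) (hη : 0 < η) :
    ∃ ε : ℝ, 0 < ε ∧ ENNReal.ofReal ε * P ≤ η / 2 := by
  have ht : Tendsto (fun ε : ℝ => ENNReal.ofReal ε * P) (nhdsWithin 0 (Ioi 0)) (nhds 0) := by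
    have h1 : Tendsto (fun ε : ℝ => ENNReal.ofReal ε) (nhdsWithin 0 (Ioi 0)) (nhds 0) := by
      have := (ENNReal.continuous_ofReal.tendsto 0).mono_left
        (nhdsWithin_le_nhds (s := Ioi (0:ℝ)))
      simpa using this
    have := ENNReal.Tendsto.mul_const h1 (Or.inr hP.ne)
    simpa using this
  have h1 := (ENNReal.tendsto_nhds_zero.1 ht) (η / 2) (ENNReal.half_pos hη.ne')
  obtain ⟨ε, h2, h3⟩ := (h1.and self_mem_nhdsWithin).exists
  exact ⟨ε, h3, h2⟩

lemma c_imp_a {a b : ℕ → ℝ} (hA : IsWaterman a) (hB : IsWaterman b) (h : PartialSumsLittleO a b) :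
    CompactEmbeddingABV a b := by
  rintro K hK ⟨M, hM, hKM⟩ hcomp
  refine ⟨fun x hx => c_imp_mem hA hB h (hK x hx), fun u hu => ?_⟩
  obtain ⟨φ, hφ, x, hxb, hx⟩ := hcomp u hu
  have huM : ∀ k, eVar a (u (φ k)) ≤ M := fun k => le_add_self.trans (hKM _ (hu _))
  have hxM : eVar a x ≤ M := eVar_lsc a hA.2.1 (fun k => u (φ k)) x M huM
    fun r hr => tendsto_pt hx hr
  refine ⟨φ, hφ, x, c_imp_mem hA hB h (hxM.trans_lt hM), ?_⟩
  set z : ℕ → ℝ → ℝ := fun k => u (φ k) - x with hz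
  have hzM : ∀ k, eVar a (z k) ≤ 2 * M := fun k => by
    rw [two_mul]; exact (eVar_sub_le a hA.2.1 _ _).trans (add_le_add (huM k) hxM)
  have h2M : 2 * M < ⊤ := ENNReal.mul_lt_top (by simp) hM
  have hzb : ∀ k, eSupNorm (z k) < ⊤ := fun k => eSup_lt_top (eVar_bdd hA.2.1 ((hzM k).trans_lt h2M))
  rw [ENNReal.tendsto_nhds_zero]
  intro η hη
  obtain ⟨ε, hε, hεη⟩ : ∃ ε : ℝ, 0 < ε ∧ ENNReal.ofReal ε * (2 * M) ≤ η / 2 := by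
    exact exists_eps h2M hη
  obtain ⟨k0, hk⟩ := littleO_eps hA.2.1 h hε
  set B := ∑ k ∈ Finset.range k0, b k
  have hB0 : 0 ≤ B := Finset.sum_nonneg fun i _ => (hB.2.1 i).le
  have hest : ∀ k, eNormABV b (z k) ≤
      (eSupNorm (z k) + ENNReal.ofReal (B * 2) * eSupNorm (z k)) + η / 2 := fun k => by
    unfold eNormABV
    rw [add_assoc]
    refine add_le_add (abs_le_eSup _ (by simp)) ?_
    refine (key_bound a b hA.2.1 hB.2.1 hB.1 hε hk (z k) (eSupNorm (z k)).toReal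
      ENNReal.toReal_nonneg fun r hr => ?_).trans (add_le_add (le_of_eq ?_) ?_)
    · exact (ENNReal.ofReal_le_iff_le_toReal (hzb k).ne).1 (abs_le_eSup _ hr)
    · rw [← mul_assoc, ENNReal.ofReal_mul (by positivity), ENNReal.ofReal_toReal (hzb k).ne]
    · exact le_trans (by gcongr; exact hzM k) hεη
  have ht : Tendsto (fun k => eSupNorm (z k) + ENNReal.ofReal (B * 2) * eSupNorm (z k)) atTop
      (nhds 0) := by
    have := hx.add (ENNReal.Tendsto.const_mul hx (Or.inr (ENNReal.ofReal_ne_top (r := B * 2))))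
    simpa using this
  have hη2 : 0 < η / 2 := ENNReal.half_pos hη.ne'
  filter_upwards [(ENNReal.tendsto_nhds_zero.1 ht) (η/2) hη2] with k hk'
  calc _ ≤ _ := hest k
    _ ≤ η / 2 + η / 2 := by gcongr
    _ = η := ENNReal.add_halves η

/-! ### Spike functions: (a) implies (c) -/

open Classical in
/-- The function with value `h` at the points `1, 1/3, 1/5, …, 1/(2n-1)` and `0` elsewhere. -/
noncomputable def spike (n : ℕ) (h : ℝ) : ℝ → ℝ :=
  fun r => if ∃ i < n, r = 1 / (2 * (i:ℝ) + 1) then h else 0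

lemma spike_cases (n : ℕ) (h r : ℝ) : spike n h r = 0 ∨ spike n h r = h := by
  unfold spike; split_ifs <;> simp

lemma spike_abs (n : ℕ) {h : ℝ} (hh : 0 ≤ h) (r : ℝ) : |spike n h r| ≤ h := by
  rcases spike_cases n h r with e | e <;> simp [e, hh, abs_of_nonneg]

lemma spike_diff (n : ℕ) {h : ℝ} (hh : 0 ≤ h) (r q : ℝ) : |spike n h r - spike n h q| ≤ h := by
  rcases spike_cases n h r with e | e <;> rcases spike_cases n h q with e' | e' <;>
    simp [e, e', hh, abs_of_nonneg]

lemma spike_count (n : ℕ) (h : ℝ) {s t : ℕ → ℝ} (hst : Nonoverlapping s t) (T : Finset ℕ)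
    (hT : ∀ k ∈ T, spike n h (t k) ≠ spike n h (s k)) : T.card ≤ 2 * n := by
  have hlt : ∀ k ∈ T, s k < t k := fun k hk =>
    lt_of_le_of_ne (hst.1 k).2.1 fun e => hT k hk (by rw [e])
  have hex : ∀ k ∈ T, ∃ p : ℕ × Bool, p.1 < n ∧
      (if p.2 then t k else s k) = 1 / (2 * (p.1:ℝ) + 1) := by
    intro k hk
    by_contra hcon
    push Not at hcon
    apply hT k hk
    have h1 : ¬ ∃ i < n, t k = 1 / (2 * (i:ℝ) + 1) := by
      rintro ⟨i, hi, e⟩; exact hcon (i, true) hi (by simpa using e)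
    have h2 : ¬ ∃ i < n, s k = 1 / (2 * (i:ℝ) + 1) := by
      rintro ⟨i, hi, e⟩; exact hcon (i, false) hi (by simpa using e)
    simp only [spike, if_neg h1, if_neg h2]
  choose! g hg1 hg2 using hex
  have hcard : T.card ≤ (Finset.range n ×ˢ (Finset.univ : Finset Bool)).card := by
    refine Finset.card_le_card_of_injOn g (fun k hk => ?_) ?_
    · simpa using hg1 k hk
    · intro k hk l hl hkl
      by_contra hne
      have hdis := hst.2 hne
      have e1 := hg2 k hk
      have e2 := hg2 l hl
      have hk' := hlt k hk
      have hl' := hlt l hl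
      rw [← hkl] at e2
      have e3 := e1.trans e2.symm
      cases hb : (g k).2
      · simp only [hb] at e3
        norm_num at e3
        obtain ⟨w, hw1, hw2⟩ := exists_between (lt_min hk' (e3 ▸ hl'))
        exact Set.disjoint_left.1 hdis (show w ∈ Ioo (s k) (t k) from
          ⟨hw1, lt_of_lt_of_le hw2 (min_le_left _ _)⟩)
          ⟨e3 ▸ hw1, lt_of_lt_of_le hw2 (min_le_right _ _)⟩
      · simp only [hb] at e3
        norm_num at e3
        obtain ⟨w, hw1, hw2⟩ := exists_between (max_lt hk' (show s l < t k from e3 ▸ hl'))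
        exact Set.disjoint_left.1 hdis (show w ∈ Ioo (s k) (t k) from
          ⟨lt_of_le_of_lt (le_max_left _ _) hw1, hw2⟩)
          ⟨lt_of_le_of_lt (le_max_right _ _) hw1, e3 ▸ hw2⟩
  simpa [mul_comm] using hcard

lemma spike_eVar {a : ℕ → ℝ} (ha : Antitone a) (h0 : ∀ n, 0 < a n) (n : ℕ) {h : ℝ} (hh : 0 ≤ h) :
    eVar a (spike n h) ≤ ENNReal.ofReal (2 * (∑ k ∈ Finset.range n, a k) * h) := by
  classical
  refine eVar_le a h0 _ _ fun s t hst N => ENNReal.ofReal_le_ofReal ?_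
  set T := (Finset.range N).filter fun k => spike n h (t k) ≠ spike n h (s k) with hT
  have h1 : ∑ k ∈ Finset.range N, a k * |spike n h (t k) - spike n h (s k)| =
      ∑ k ∈ T, a k * |spike n h (t k) - spike n h (s k)| := by
    rw [hT, Finset.sum_filter_of_ne]
    intro k _ hk e
    apply hk
    rw [e]; simp
  rw [h1]
  calc _ ≤ ∑ k ∈ T, a k * h := by
        refine Finset.sum_le_sum fun k _ => mul_le_mul_of_nonneg_left (spike_diff n hh _ _) (h0 k).le
    _ = (∑ k ∈ T, a k) * h := by rw [Finset.sum_mul]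
    _ ≤ (∑ k ∈ Finset.range (2 * n), a k) * h := by
        refine mul_le_mul_of_nonneg_right ?_ hh
        refine sum_le_psum ha h0 _ T (spike_count n h hst T fun k hk => ?_)
        exact (Finset.mem_filter.1 hk).2
    _ ≤ _ := by
        gcongr
        exact psum_two_mul ha n

lemma spike_eVar_ge {b : ℕ → ℝ} (h0 : ∀ n, 0 < b n) (n : ℕ) {h : ℝ} (hh : 0 ≤ h) :
    ENNReal.ofReal ((∑ k ∈ Finset.range n, b k) * h) ≤ eVar b (spike n h) := by
  have hst : Nonoverlapping (fun k : ℕ => 1 / (2 * (k:ℝ) + 2)) (fun k : ℕ => 1 / (2 * (k:ℝ) + 1)) := by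
    constructor
    · intro k
      refine ⟨by positivity, ?_, ?_⟩
      · apply one_div_le_one_div_of_le <;> first | positivity | linarith
      · rw [div_le_one (by positivity)]
        have : (0:ℝ) ≤ k := k.cast_nonneg
        linarith
    · have key : ∀ m n : ℕ, m < n → Disjoint
          (Ioo (1 / (2 * (m:ℝ) + 2)) (1 / (2 * (m:ℝ) + 1)))
          (Ioo (1 / (2 * (n:ℝ) + 2)) (1 / (2 * (n:ℝ) + 1))) := by
        intro m n hmn
        rw [Set.disjoint_left]
        rintro w ⟨h1, _⟩ ⟨_, h2⟩
        have hmn' : (m:ℝ) + 1 ≤ n := by exact_mod_cast hmn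
        have : 1 / (2 * (n:ℝ) + 1) ≤ 1 / (2 * (m:ℝ) + 2) := by
          apply one_div_le_one_div_of_le <;> first | positivity | linarith
        linarith
      intro m n hmn
      rcases lt_or_gt_of_ne hmn with hl | hl
      · exact key m n hl
      · exact (key n m hl).symm
  refine le_trans (ENNReal.ofReal_le_ofReal (le_of_eq ?_)) (fin_le_eVar b h0 (spike n h) hst n)
  rw [Finset.sum_mul]
  refine Finset.sum_congr rfl fun k hk => ?_
  have e1 : spike n h (1 / (2 * (k:ℝ) + 1)) = h := if_pos ⟨k, Finset.mem_range.1 hk, rfl⟩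
  have e2 : spike n h (1 / (2 * (k:ℝ) + 2)) = 0 := by
    refine if_neg ?_
    rintro ⟨i, _, e⟩
    rw [div_eq_div_iff (by positivity) (by positivity)] at e
    have : 2 * i + 1 = 2 * k + 2 := by exact_mod_cast (by linarith : 2 * (i:ℝ) + 1 = 2 * k + 2)
    omega
  rw [e1, e2, sub_zero, abs_of_nonneg hh]

lemma relComp_range (y : ℕ → ℝ → ℝ) (hb : ∀ j, BoundedOn01 (y j))
    (h0 : Tendsto (fun j => eSupNorm (y j)) atTop (nhds 0)) : RelCompSup (Set.range y) := by
  intro u hu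
  choose g hg using hu
  by_cases hc : ∃ c, ∃ᶠ j in atTop, g j = c
  · obtain ⟨c, hc⟩ := hc
    obtain ⟨φ, hφ, hφc⟩ := extraction_of_frequently_atTop hc
    refine ⟨φ, hφ, y c, hb c, ?_⟩
    have : ∀ k, eSupNorm (u (φ k) - y c) = 0 := fun k => by
      rw [← hg, hφc k]; simp [eSupNorm]
    simp [this]
  · push Not at hc
    have ht : Tendsto g atTop atTop := by
      rw [tendsto_atTop]
      intro n
      have h1 : ∀ᶠ j in atTop, ∀ c ∈ Finset.range n, g j ≠ c :=
        (Filter.eventually_all_finset _).2 fun c _ => by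
          have := hc c
          simpa [Filter.Frequently] using this
      filter_upwards [h1] with j hj
      by_contra hlt
      exact hj (g j) (Finset.mem_range.2 (by omega)) rfl
    refine ⟨id, strictMono_id, 0, ⟨0, by simp⟩, ?_⟩
    have := h0.comp ht
    refine this.congr fun k => ?_
    simp [hg]

lemma not_c_freq {a b : ℕ → ℝ} (ha : ∀ n, 0 < a n) (hb : ∀ n, 0 < b n)
    (h : ¬ PartialSumsLittleO a b) : ∃ ε : ℝ, 0 < ε ∧ ∃ᶠ n in atTop,
      ε * ∑ k ∈ Finset.range n, a k ≤ ∑ k ∈ Finset.range n, b k := by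
  by_contra hcon
  push Not at hcon
  apply h
  unfold PartialSumsLittleO
  rw [Metric.tendsto_nhds]
  intro ε hε
  have := hcon ε hε
  filter_upwards [this, eventually_gt_atTop 0] with n hn hpos
  have h1 := psum_pos ha hpos
  have h2 := psum_pos hb hpos
  rw [Real.dist_eq, sub_zero, abs_of_pos (div_pos h2 h1), div_lt_iff₀ h1]
  exact hn

lemma a_imp_c {a b : ℕ → ℝ} (hA : IsWaterman a) (hB : IsWaterman b)
    (h : CompactEmbeddingABV a b) : PartialSumsLittleO a b := by
  by_contra hc
  obtain ⟨ε, hε, hfr⟩ := not_c_freq hA.2.1 hB.2.1 hc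
  obtain ⟨ψ, hψ, hψP⟩ := extraction_of_frequently_atTop (hfr.and_eventually (eventually_gt_atTop 0))
  set As : ℕ → ℝ := fun j => ∑ k ∈ Finset.range (ψ j), a k with hAs
  have hAp : ∀ j, 0 < As j := fun j => psum_pos hA.2.1 (hψP j).2
  set y : ℕ → ℝ → ℝ := fun j => spike (ψ j) (1 / As j) with hy
  have hhp : ∀ j, 0 ≤ 1 / As j := fun j => by have := hAp j; positivity
  have hya : ∀ j, eVar a (y j) ≤ 2 := fun j => by
    refine (spike_eVar hA.1 hA.2.1 (ψ j) (hhp j)).trans (le_of_eq ?_)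
    have : 2 * As j * (1 / As j) = 2 := by have := (hAp j).ne'; field_simp
    simp only [hAs] at this ⊢
    rw [this]; simp
  have hyb : ∀ j, ENNReal.ofReal ε ≤ eVar b (y j) := fun j => by
    refine le_trans (ENNReal.ofReal_le_ofReal ?_) (spike_eVar_ge hB.2.1 (ψ j) (hhp j))
    rw [mul_one_div, le_div_iff₀ (hAp j)]
    exact (hψP j).1
  have hinv : Tendsto (fun j => ENNReal.ofReal (1 / As j)) atTop (nhds 0) := by
    have h1 : Tendsto As atTop atTop := (psum_tendsto hA).comp hψ.tendsto_atTop
    have h2 := ENNReal.tendsto_ofReal (h1.inv_tendsto_atTop)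
    simpa using h2
  have hysup : Tendsto (fun j => eSupNorm (y j)) atTop (nhds 0) := by
    refine tendsto_of_tendsto_of_tendsto_of_le_of_le tendsto_const_nhds hinv (fun _ => zero_le)
      fun j => iSup₂_le fun r _ => ENNReal.ofReal_le_ofReal (spike_abs _ (hhp j) r)
  obtain ⟨_, hrel⟩ := h (Set.range y) (by
      rintro _ ⟨j, rfl⟩; exact (hya j).trans_lt (by simp)) (by
      refine ⟨ENNReal.ofReal (1 / a 0) + 2, by simp, ?_⟩
      rintro _ ⟨j, rfl⟩
      refine add_le_add (ENNReal.ofReal_le_ofReal ((spike_abs _ (hhp j) 0).trans ?_)) (hya j)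
      refine one_div_le_one_div_of_le (hA.2.1 0) ?_
      have := psum_mono hA.2.1 (Nat.succ_le_of_lt (hψP j).2)
      simpa using this)
    (relComp_range y (fun j => ⟨1 / As j, fun r _ => spike_abs _ (hhp j) r⟩) hysup)
  obtain ⟨φ, hφ, x, _, hx⟩ := hrel y fun j => ⟨j, rfl⟩
  have hx1 : Tendsto (fun k => ENNReal.ofReal |(y (φ k) - x) 0|) atTop (nhds 0) :=
    tendsto_of_tendsto_of_tendsto_of_le_of_le tendsto_const_nhds hx (fun _ => zero_le)
      fun k => le_self_add
  have hx2 : Tendsto (fun k => eVar b (y (φ k) - x)) atTop (nhds 0) :=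
    tendsto_of_tendsto_of_tendsto_of_le_of_le tendsto_const_nhds hx (fun _ => zero_le)
      fun k => le_add_self
  have hyt : ∀ r ∈ Icc (0:ℝ) 1, Tendsto (fun k => y (φ k) r) atTop (nhds 0) := fun r hr => by
    have := tendsto_pt (v := fun k => y (φ k)) (x := 0) (by
      simpa [Function.comp_def] using hysup.comp hφ.tendsto_atTop) hr
    simpa using this
  have hlim : ∀ f : ℕ → ℝ, ∀ l : ℝ, Tendsto f atTop (nhds l) →
      Tendsto (fun k => ENNReal.ofReal (f k)) atTop (nhds 0) → l ≤ 0 := fun f l h1 h2 => by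
    have := tendsto_nhds_unique (ENNReal.tendsto_ofReal h1) h2
    simpa using this
  have hx00 : x 0 = 0 := by
    have h1 := hlim _ _ (((hyt 0 (by simp)).sub_const (x 0)).abs) hx1
    simpa using h1
  have hx0 : ∀ r ∈ Icc (0:ℝ) 1, x r = 0 := fun r hr => by
    have h2 : Tendsto (fun k => ENNReal.ofReal (b 0 * |(y (φ k) - x) r - (y (φ k) - x) 0|))
        atTop (nhds 0) :=
      tendsto_of_tendsto_of_tendsto_of_le_of_le tendsto_const_nhds hx2 (fun _ => zero_le)
        fun k => point_le_eVar b hB.2.1 _ hr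
    have h1 := hlim _ _ (((((hyt r hr).sub_const (x r)).sub
      ((hyt 0 (by simp)).sub_const (x 0))).abs).const_mul (b 0)) h2
    have h3 := hB.2.1 0
    simp only [hx00, zero_sub, sub_zero, abs_neg] at h1
    by_contra hne
    have : 0 < |x r| := abs_pos.2 hne
    nlinarith [mul_pos h3 this]
  have heq : ∀ k, eVar b (y (φ k) - x) = eVar b (y (φ k)) := fun k => by
    unfold eVar
    refine iSup_congr fun p => tsum_congr fun n => ?_
    have := p.2.1 n
    simp [hx0 (p.1.1 n) ⟨this.1, by linarith⟩, hx0 (p.1.2 n) ⟨by linarith, this.2.2⟩]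
  have := ge_of_tendsto' hx2 (b := ENNReal.ofReal ε) fun k => by rw [heq]; exact hyb _
  simp at this
  linarith

/-! ### Katetov order: (c) implies (b) -/

lemma psum_tail {a : ℕ → ℝ} (ha : Antitone a) (h0 : ∀ n, 0 < a n) {k n : ℕ} (h : k ≤ n) :
    ∑ i ∈ Finset.range n, a i ≤ ∑ i ∈ Finset.range k, a i + n * a k := by
  obtain ⟨l, rfl⟩ := Nat.exists_eq_add_of_le h
  rw [Finset.sum_range_add]
  gcongr
  calc ∑ x ∈ Finset.range l, a (k + x) ≤ ∑ x ∈ Finset.range l, a k :=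
        Finset.sum_le_sum fun i _ => ha (by omega)
    _ = l * a k := by simp
    _ ≤ _ := by
      have := h0 k
      gcongr
      omega

lemma katetov_of_bounds {a c : ℕ → ℝ} (hA : IsWaterman a) (hc : ∀ n, 0 < c n) {D : ℝ} (hD : 0 < D)
    (h1 : ∀ n : ℕ, c n * ((n + 1 : ℕ) : ℝ) ≤ D * ∑ k ∈ Finset.range (n + 1), a k)
    (h2 : ∀ n : ℕ, ∑ k ∈ Finset.range (n + 1), c k ≤ D * ∑ k ∈ Finset.range (n + 1), a k) :
    KatetovLE (IdealOf a) (IdealOf c) := by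
  classical
  have hex : ∀ n, ∃ k, ∑ i ∈ Finset.range (n + 1), c i ≤ 2 * D * ∑ i ∈ Finset.range (k + 1), a i := by
    intro n
    refine ⟨n, (h2 n).trans ?_⟩
    have := psum_pos hA.2.1 (Nat.succ_pos n)
    simp only [Nat.succ_eq_add_one] at this
    nlinarith [mul_pos hD this]
  set f : ℕ → ℕ := fun n => Nat.find (hex n) with hf
  have hf1 : ∀ n, ∑ i ∈ Finset.range (n + 1), c i ≤ 2 * D * ∑ i ∈ Finset.range (f n + 1), a i :=
    fun n => Nat.find_spec (hex n)
  have hf2 : ∀ n, 2 * D * ∑ i ∈ Finset.range (f n), a i < ∑ i ∈ Finset.range (n + 1), c i := by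
    intro n
    rcases hk : f n with _ | j
    · simpa using psum_pos hc (Nat.succ_pos n)
    · have := Nat.find_min (hex n) (m := j) (by simp only [hf] at hk; omega)
      exact not_le.1 this
  have hfn : ∀ n, f n ≤ n := fun n => Nat.find_min' (hex n) ((h2 n).trans (by
    have := psum_pos hA.2.1 (Nat.succ_pos n)
    simp only [Nat.succ_eq_add_one] at this
    nlinarith [mul_pos hD this]))
  have hca : ∀ n, c n ≤ 2 * D * a (f n) := by
    intro n
    have e1 := psum_tail hA.1 hA.2.1 (show f n ≤ n + 1 from (hfn n).trans (Nat.le_succ n))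
    have e2 := (hf2 n).trans_le (h2 n)
    have e3 := h1 n
    have hn : (0:ℝ) < ((n + 1 : ℕ) : ℝ) := by positivity
    refine le_of_mul_le_mul_right ?_ hn
    have e4 := mul_le_mul_of_nonneg_left e1 hD.le
    nlinarith
  have hblock : ∀ (F : Finset ℕ) (k : ℕ), (∀ n ∈ F, f n = k) → ∑ n ∈ F, c n ≤ 4 * D * a k := by
    intro F k hF
    have hak := hA.2.1 k
    rcases F.eq_empty_or_nonempty with rfl | hne
    · simp; positivity
    set p := F.min' hne
    set q := F.max' hne
    have hp := F.min'_mem hne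
    have hq := F.max'_mem hne
    have hpq : p ≤ q := F.min'_le _ hq
    have hsub : F ⊆ Finset.Ico p (q + 1) := fun i hi => by
      have := F.min'_le i hi
      have := F.le_max' i hi
      simp only [Finset.mem_Ico]; omega
    have e1 : ∑ n ∈ F, c n ≤ ∑ n ∈ Finset.Ico p (q + 1), c n :=
      Finset.sum_le_sum_of_subset_of_nonneg hsub fun i _ _ => (hc i).le
    rw [Finset.sum_Ico_eq_sub _ (by omega)] at e1
    have e2 := hf1 q
    have e3 := hf2 p
    have e4 := hca p
    rw [hF q hq, Finset.sum_range_succ, Finset.sum_range_succ a] at e2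
    rw [hF p hp, Finset.sum_range_succ] at e3
    rw [hF p hp] at e4
    rw [Finset.sum_range_succ] at e1
    linarith
  refine ⟨f, fun C hC => ?_⟩
  have hC' : Summable (C.indicator a) := summable_subtype_iff_indicator.1 hC
  refine (summable_subtype_iff_indicator (f := c)).2 ?_
  refine summable_of_sum_le (c := 4 * D * ∑' k, C.indicator a k)
    (fun n => Set.indicator_nonneg (fun i _ => (hc i).le) n) fun F => ?_
  set F' := F.filter fun n => f n ∈ C with hF'
  have e1 : ∑ n ∈ F, (f ⁻¹' C).indicator c n = ∑ n ∈ F', c n := by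
    rw [hF', Finset.sum_filter]
    refine Finset.sum_congr rfl fun n _ => ?_
    simp [Set.indicator_apply]
  rw [e1, ← Finset.sum_fiberwise_of_maps_to (t := F'.image f) (g := f)
    (fun i hi => Finset.mem_image_of_mem f hi)]
  calc _ ≤ ∑ k ∈ F'.image f, 4 * D * C.indicator a k := by
        refine Finset.sum_le_sum fun k hk => ?_
        obtain ⟨n, hn, rfl⟩ := Finset.mem_image.1 hk
        have : f n ∈ C := (Finset.mem_filter.1 hn).2
        rw [Set.indicator_of_mem this]
        exact hblock _ _ fun i hi => (Finset.mem_filter.1 hi).2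
    _ = 4 * D * ∑ k ∈ F'.image f, C.indicator a k := by rw [Finset.mul_sum]
    _ ≤ _ := by
        gcongr
        exact hC'.sum_le_tsum _ fun i _ => Set.indicator_nonneg (fun i _ => (hA.2.1 i).le) i

/-- The weight in `seqM`. -/
def wM (m : ℕ → ℕ) (n : ℕ) : ℕ := max 1 (((Finset.range (n + 1)).filter fun j => m j ≤ n).card)

lemma wM_mono (m : ℕ → ℕ) : Monotone (wM m) := by
  intro p q h
  refine max_le_max le_rfl (Finset.card_le_card fun j hj => ?_)
  simp only [Finset.mem_filter, Finset.mem_range] at hj ⊢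
  omega

lemma c_imp_b {a b : ℕ → ℝ} (hA : IsWaterman a) (hB : IsWaterman b) (h : PartialSumsLittleO a b) :
    ∃ m : ℕ → ℕ, StrictMono m ∧ KatetovLE (IdealOf a) (IdealOf (seqM b m)) := by
  have hev : ∀ j : ℕ, ∀ᶠ N in atTop, ∀ n ≥ N, ((j + 1 : ℕ) : ℝ) * ∑ k ∈ Finset.range (n + 1), b k ≤
      ∑ k ∈ Finset.range (n + 1), a k := by
    intro j
    have hj : (0:ℝ) < ((j + 1 : ℕ) : ℝ) := by positivity
    obtain ⟨k0, hk⟩ := littleO_eps hA.2.1 h (ε := 1 / ((j + 1 : ℕ) : ℝ)) (by positivity)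
    filter_upwards [eventually_ge_atTop k0] with N hN n hn
    have := hk (n + 1) (by omega)
    rw [one_div_mul_eq_div, le_div_iff₀ hj] at this
    linarith
  obtain ⟨m, hm, hmP⟩ := extraction_forall_of_eventually hev
  obtain ⟨D0, hD0⟩ := h.bddAbove_range
  set D := max 1 D0 with hDdef
  have hD1 : 1 ≤ D := le_max_left _ _
  have hBD : ∀ n : ℕ, ∑ k ∈ Finset.range (n + 1), b k ≤ D * ∑ k ∈ Finset.range (n + 1), a k := by
    intro n
    have h1 := hD0 ⟨n + 1, rfl⟩
    simp only at h1
    have h2 := h1.trans (le_max_right 1 D0)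
    rwa [div_le_iff₀ (psum_pos hA.2.1 (Nat.succ_pos n))] at h2
  have hw : ∀ n : ℕ, (wM m n : ℝ) * ∑ k ∈ Finset.range (n + 1), b k ≤
      D * ∑ k ∈ Finset.range (n + 1), a k := by
    intro n
    set T := (Finset.range (n + 1)).filter fun j => m j ≤ n with hT
    have hwT : wM m n = max 1 T.card := rfl
    rcases Nat.eq_zero_or_pos T.card with h0 | hpos
    · rw [hwT, h0]; simpa using hBD n
    · have hne := Finset.card_pos.1 hpos
      have hmax := T.max'_mem hne
      set j := T.max' hne
      have hcard : T.card ≤ j + 1 := by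
        have : T ⊆ Finset.range (j + 1) := fun i hi => by
          have := T.le_max' i hi
          simp only [Finset.mem_range]; omega
        simpa using Finset.card_le_card this
      have hmj : m j ≤ n := (Finset.mem_filter.1 hmax).2
      have h1 := hmP j n hmj
      have hwj : (wM m n : ℝ) ≤ ((j + 1 : ℕ) : ℝ) := by
        rw [hwT]; exact_mod_cast max_le (by omega) hcard
      have hBp := psum_pos hB.2.1 (Nat.succ_pos n)
      have hAp := psum_pos hA.2.1 (Nat.succ_pos n)
      simp only [Nat.succ_eq_add_one] at hBp hAp
      nlinarith [mul_le_mul_of_nonneg_right hwj hBp.le]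
  have hw1 : ∀ n, 1 ≤ wM m n := fun n => le_max_left _ _
  have hseq : ∀ n, seqM b m n = (wM m n : ℝ) * b n := fun n => rfl
  refine ⟨m, hm, katetov_of_bounds hA (D := D) (fun n => ?_) (by linarith) (fun n => ?_) fun n => ?_⟩
  · rw [hseq]
    have : (0:ℝ) < wM m n := by exact_mod_cast hw1 n
    exact mul_pos this (hB.2.1 n)
  · refine le_trans ?_ (hw n)
    rw [hseq, mul_assoc]
    refine mul_le_mul_of_nonneg_left ?_ (by positivity)
    have : ∑ k ∈ Finset.range (n + 1), b n ≤ ∑ k ∈ Finset.range (n + 1), b k :=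
      Finset.sum_le_sum fun i hi => hB.1 (by simp at hi; omega)
    simp only [Finset.sum_const, Finset.card_range, nsmul_eq_mul] at this
    linarith
  · refine le_trans ?_ (hw n)
    rw [Finset.mul_sum]
    refine Finset.sum_le_sum fun k hk => ?_
    rw [hseq]
    refine mul_le_mul_of_nonneg_right ?_ (hB.2.1 k).le
    exact_mod_cast wM_mono m (by simp at hk; omega)

/-! ### (b) implies (c) -/

lemma split_bound (a φ : ℕ → ℝ) (ha : ∀ n, 0 < a n) {δ L : ℝ} (hδ : 0 < δ) (hL : 0 ≤ L)
    (S : Finset ℕ) (hS : ∀ k ∈ S, a k ≤ δ / 2)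
    (hF : ∀ F ⊆ S, ∑ k ∈ F, a k ≤ δ → ∑ k ∈ F, φ k ≤ L) :
    ∑ k ∈ S, φ k ≤ L + 2 * L / δ * ∑ k ∈ S, a k := by
  classical
  have key : ∀ T ⊆ S, ∃ G ⊆ T, ∑ k ∈ G, a k ≤ δ ∧
      ∑ k ∈ T \ G, φ k ≤ 2 * L / δ * ∑ k ∈ T \ G, a k := by
    intro T
    induction T using Finset.induction_on with
    | empty => intro _; exact ⟨∅, by simp, by simpa using hδ.le, by simp⟩
    | insert k T hk ih =>
      intro hT
      obtain ⟨G, hG, h1, h2⟩ := ih fun i hi => hT (Finset.mem_insert_of_mem hi)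
      have hkS : k ∈ S := hT (Finset.mem_insert_self _ _)
      have hkG : k ∉ G := fun h => hk (hG h)
      by_cases hc : a k + ∑ i ∈ G, a i ≤ δ
      · refine ⟨insert k G, Finset.insert_subset_insert _ hG, by rwa [Finset.sum_insert hkG], ?_⟩
        have : insert k T \ insert k G = T \ G := by
          ext i; simp only [Finset.mem_sdiff, Finset.mem_insert]
          constructor
          · tauto
          · rintro ⟨hi, hi'⟩
            exact ⟨Or.inr hi, by rintro (rfl | h); exacts [hk hi, hi' h]⟩
        rwa [this]
      · refine ⟨{k}, by simp, by simpa using (hS k hkS).trans (by linarith), ?_⟩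
        have : insert k T \ {k} = T := by
          ext i; simp only [Finset.mem_sdiff, Finset.mem_insert, Finset.mem_singleton]
          constructor
          · tauto
          · intro hi; exact ⟨Or.inr hi, by rintro rfl; exact hk hi⟩
        rw [this, ← Finset.sum_sdiff hG, ← Finset.sum_sdiff (f := a) hG]
        have h3 := hF G (hG.trans fun i hi => hT (Finset.mem_insert_of_mem hi)) h1
        have h4 := hS k hkS
        have h5 : δ / 2 ≤ ∑ i ∈ G, a i := by linarith
        have h6 : L ≤ 2 * L / δ * ∑ i ∈ G, a i := by
          calc L = 2 * L / δ * (δ / 2) := by field_simp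
            _ ≤ _ := by gcongr
        rw [mul_add]; linarith
  obtain ⟨G, hG, h1, h2⟩ := key S subset_rfl
  rw [← Finset.sum_sdiff hG, ← Finset.sum_sdiff (f := a) hG]
  have h3 := hF G hG h1
  have h4 : 0 ≤ 2 * L / δ * ∑ i ∈ G, a i :=
    mul_nonneg (by positivity) (Finset.sum_nonneg fun i _ => (ha i).le)
  rw [mul_add]; linarith

lemma katetov_unif {a c : ℕ → ℝ} (ha : ∀ n, 0 < a n) (hc : ∀ n, 0 < c n) (f : ℕ → ℕ)
    (hf : ∀ C ∈ IdealOf a, f ⁻¹' C ∈ IdealOf c) :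
    ∃ δ L : ℝ, 0 < δ ∧ 0 ≤ L ∧ ∀ T : Finset ℕ, ∑ k ∈ T.image f, a k ≤ δ → ∑ n ∈ T, c n ≤ L := by
  classical
  by_contra hcon
  push Not at hcon
  have : ∀ i : ℕ, ∃ T : Finset ℕ, ∑ k ∈ T.image f, a k ≤ (1/2:ℝ)^i ∧ (i:ℝ) < ∑ n ∈ T, c n :=
    fun i => hcon _ _ (by positivity) (by positivity)
  choose T hT1 hT2 using this
  set C : Set ℕ := {k | ∃ i, k ∈ (T i).image f} with hC
  have hCa : C ∈ IdealOf a := by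
    refine (summable_subtype_iff_indicator (f := a)).2 ?_
    refine summable_of_sum_le (c := ∑' i : ℕ, (1/2:ℝ)^i)
      (fun n => Set.indicator_nonneg (fun i _ => (ha i).le) n) fun F => ?_
    have hch : ∀ k ∈ F.filter (· ∈ C), ∃ i, k ∈ (T i).image f := fun k hk =>
      (Finset.mem_filter.1 hk).2
    choose! g hg using hch
    have e1 : ∑ n ∈ F, C.indicator a n = ∑ n ∈ F.filter (· ∈ C), a n := by
      rw [Finset.sum_filter]
      exact Finset.sum_congr rfl fun n _ => by simp [Set.indicator_apply]
    rw [e1, ← Finset.sum_fiberwise_of_maps_to (t := (F.filter (· ∈ C)).image g) (g := g)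
      (fun i hi => Finset.mem_image_of_mem g hi)]
    refine le_trans (Finset.sum_le_sum (g := fun i => (1/2:ℝ)^i) fun i _ => ?_)
      (summable_geometric_two.sum_le_tsum _ fun i _ => by positivity)
    refine le_trans (Finset.sum_le_sum_of_subset_of_nonneg (fun k hk => ?_)
      fun k _ _ => (ha k).le) (hT1 i)
    have hk' := Finset.mem_filter.1 hk
    have := hg k hk'.1
    rwa [hk'.2] at this
  have hsum : Summable ((f ⁻¹' C).indicator c) := summable_subtype_iff_indicator.1 (hf C hCa)
  obtain ⟨i, hi⟩ := exists_nat_gt (∑' n, (f ⁻¹' C).indicator c n)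
  have h1 := hsum.sum_le_tsum (T i) fun n _ => Set.indicator_nonneg (fun i _ => (hc i).le) n
  have h2 : ∑ n ∈ T i, (f ⁻¹' C).indicator c n = ∑ n ∈ T i, c n :=
    Finset.sum_congr rfl fun n hn => Set.indicator_of_mem (show n ∈ f ⁻¹' C from
      ⟨i, Finset.mem_image_of_mem f hn⟩) c
  linarith [hT2 i]

lemma c_of_not_null {a b : ℕ → ℝ} (hA : IsWaterman a) (hB : IsProperWaterman b)
    (h : ¬ Tendsto a atTop (nhds 0)) : PartialSumsLittleO a b := by
  obtain ⟨α, hα, hα'⟩ : ∃ α : ℝ, 0 < α ∧ ∀ n, α ≤ a n := by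
    by_contra hcon
    push Not at hcon
    apply h
    rw [Metric.tendsto_atTop]
    intro ε hε
    obtain ⟨N, hN⟩ := hcon ε hε
    refine ⟨N, fun n hn => ?_⟩
    rw [Real.dist_eq, sub_zero, abs_of_pos (hA.2.1 n)]
    exact (hA.1 hn).trans_lt hN
  have h1 : Tendsto (fun n : ℕ => (n:ℝ)⁻¹ * ∑ k ∈ Finset.range n, b k) atTop (nhds 0) := hB.2.cesaro
  have h2 := h1.const_mul (1 / α)
  rw [mul_zero] at h2
  refine tendsto_of_tendsto_of_tendsto_of_le_of_le' tendsto_const_nhds h2 ?_ ?_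
  · exact Eventually.of_forall fun n => div_nonneg (Finset.sum_nonneg fun i _ => (hB.1.2.1 i).le)
      (Finset.sum_nonneg fun i _ => (hA.2.1 i).le)
  · filter_upwards [eventually_gt_atTop 0] with n hn
    have hn' : (0:ℝ) < n := by exact_mod_cast hn
    have h3 : n * α ≤ ∑ k ∈ Finset.range n, a k := by
      have : ∑ k ∈ Finset.range n, α ≤ ∑ k ∈ Finset.range n, a k := Finset.sum_le_sum fun i _ => hα' i
      simpa using this
    calc _ ≤ (∑ k ∈ Finset.range n, b k) / (n * α) :=
          div_le_div_of_nonneg_left (Finset.sum_nonneg fun i _ => (hB.1.2.1 i).le) (by positivity) h3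
      _ = _ := by field_simp

lemma katetov_linear {a c : ℕ → ℝ} (hA : IsWaterman a) (h0 : Tendsto a atTop (nhds 0))
    (hc : ∀ n, 0 < c n) (f : ℕ → ℕ) (hf : ∀ C ∈ IdealOf a, f ⁻¹' C ∈ IdealOf c) :
    ∃ K : ℝ, 0 < K ∧ ∀ n, 0 < n →
      ∑ k ∈ Finset.range n, c k ≤ K * ∑ k ∈ Finset.range n, a k := by
  classical
  obtain ⟨δ, L, hδ, hL, hT⟩ := katetov_unif hA.2.1 hc f hf
  obtain ⟨k0, hk0⟩ := eventually_atTop.1 (h0.eventually (gt_mem_nhds (half_pos hδ)))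
  have hfin : (Set.Iio k0) ∈ IdealOf a := by
    have : Finite (Set.Iio k0) := (Set.finite_Iio k0).to_subtype
    exact Summable.of_finite
  have hs : Summable ((f ⁻¹' Set.Iio k0).indicator c) :=
    summable_subtype_iff_indicator.1 (hf _ hfin)
  set H := ∑' n, (f ⁻¹' Set.Iio k0).indicator c n with hH
  have hH0 : 0 ≤ H := tsum_nonneg fun n => Set.indicator_nonneg (fun i _ => (hc i).le) n
  have ha0 := hA.2.1 0
  refine ⟨(H + L) / a 0 + 2 * L / δ + 1, by positivity, fun n hn => ?_⟩
  have hsplit := Finset.sum_filter_add_sum_filter_not (Finset.range n) (fun i => f i < k0) c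
  have e1 : ∑ i ∈ (Finset.range n).filter (fun i => f i < k0), c i ≤ H := by
    refine le_trans (le_of_eq ?_) (hs.sum_le_tsum (Finset.range n)
      fun n _ => Set.indicator_nonneg (fun i _ => (hc i).le) n)
    rw [Finset.sum_filter]
    exact Finset.sum_congr rfl fun i _ => by simp [Set.indicator_apply]
  set R := (Finset.range n).filter (fun i => ¬ f i < k0) with hR
  have hφ : ∀ F ⊆ R.image f, ∑ k ∈ F, ∑ i ∈ R with f i = k, c i =
      ∑ i ∈ R.filter (fun i => f i ∈ F), c i := by
    intro F _
    rw [← Finset.sum_fiberwise_of_maps_to (s := R.filter (fun i => f i ∈ F)) (t := F) (g := f)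
      (fun i hi => (Finset.mem_filter.1 hi).2)]
    refine Finset.sum_congr rfl fun k hk => Finset.sum_congr ?_ fun _ _ => rfl
    ext i
    simp only [Finset.mem_filter]
    constructor
    · rintro ⟨h1, h2⟩; exact ⟨⟨h1, h2 ▸ hk⟩, h2⟩
    · rintro ⟨⟨h1, _⟩, h2⟩; exact ⟨h1, h2⟩
  have e2 := split_bound a (fun k => ∑ i ∈ R with f i = k, c i) hA.2.1 hδ hL (R.image f) (by
      intro k hk
      obtain ⟨i, hi, rfl⟩ := Finset.mem_image.1 hk
      have := (Finset.mem_filter.1 hi).2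
      exact (hk0 _ (by omega)).le) (by
      intro F hF hFδ
      rw [hφ F hF]
      refine hT _ (le_trans (Finset.sum_le_sum_of_subset_of_nonneg ?_
        fun i _ _ => (hA.2.1 i).le) hFδ)
      intro k hk
      obtain ⟨i, hi, rfl⟩ := Finset.mem_image.1 hk
      exact (Finset.mem_filter.1 hi).2)
  rw [hφ _ subset_rfl] at e2
  have e3 : R.filter (fun i => f i ∈ R.image f) = R :=
    Finset.filter_true_of_mem fun i hi => Finset.mem_image_of_mem f hi
  rw [e3] at e2
  have e4 : ∑ k ∈ R.image f, a k ≤ ∑ k ∈ Finset.range n, a k := by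
    refine sum_le_psum hA.1 hA.2.1 n _ (Finset.card_image_le.trans ?_)
    exact (Finset.card_filter_le (Finset.range n) (fun i => ¬ f i < k0)).trans (by simp)
  have e5 : a 0 ≤ ∑ k ∈ Finset.range n, a k := by
    have := psum_mono hA.2.1 (Nat.succ_le_of_lt hn)
    simpa using this
  have e6 : H + L ≤ (H + L) / a 0 * ∑ k ∈ Finset.range n, a k := by
    calc H + L = (H + L) / a 0 * a 0 := by field_simp
      _ ≤ _ := by gcongr
  have e7 : 2 * L / δ * ∑ k ∈ R.image f, a k ≤ 2 * L / δ * ∑ k ∈ Finset.range n, a k := by gcongr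
  rw [add_mul, add_mul]
  linarith

lemma b_imp_c {a b : ℕ → ℝ} (hA : IsWaterman a) (hB : IsProperWaterman b) {m : ℕ → ℕ}
    (hm : StrictMono m) (h : KatetovLE (IdealOf a) (IdealOf (seqM b m))) :
    PartialSumsLittleO a b := by
  by_cases h0 : Tendsto a atTop (nhds 0)
  swap
  · exact c_of_not_null hA hB h0
  obtain ⟨f, hf⟩ := h
  have hb := hB.1.2.1
  have hw1 : ∀ n, 1 ≤ wM m n := fun n => le_max_left _ _
  have hseq : ∀ n, seqM b m n = (wM m n : ℝ) * b n := fun n => rfl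
  have hc : ∀ n, 0 < seqM b m n := fun n => by
    rw [hseq]
    have : (0:ℝ) < wM m n := by exact_mod_cast hw1 n
    exact mul_pos this (hb n)
  obtain ⟨K, hK, hKn⟩ := katetov_linear hA h0 hc f hf
  have hwR : ∀ R n : ℕ, m R ≤ n → R ≤ wM m n := by
    intro R n hn
    refine le_trans ?_ (le_max_right _ _)
    have : Finset.range R ⊆ (Finset.range (n + 1)).filter fun j => m j ≤ n := fun j hj => by
      have h1 := Finset.mem_range.1 hj
      have h2 := hm h1
      have h3 := hm.id_le R
      simp only [id] at h3
      simp only [Finset.mem_filter, Finset.mem_range]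
      omega
    simpa using Finset.card_le_card this
  by_contra hcon
  obtain ⟨ε, hε, hfr⟩ := not_c_freq hA.2.1 hb hcon
  obtain ⟨R, hR⟩ := exists_nat_gt (2 * K / ε)
  have hR0 : (0:ℝ) < R := lt_trans (by positivity) hR
  set B0 := ∑ k ∈ Finset.range (m R), b k with hB0
  have hbig := (psum_tendsto hA).eventually_gt_atTop (2 * B0 / ε)
  obtain ⟨n, hn1, hn2, hn3, hn4⟩ := (hfr.and_eventually
    (hbig.and ((eventually_gt_atTop 0).and (eventually_ge_atTop (m R))))).exists
  have e1 : (R:ℝ) * ∑ k ∈ Finset.range n, b k ≤ R * B0 + ∑ k ∈ Finset.range n, seqM b m k := by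
    rw [← Finset.sum_range_add_sum_Ico b hn4, ← Finset.sum_range_add_sum_Ico (seqM b m) hn4, mul_add]
    have p1 : 0 ≤ ∑ k ∈ Finset.range (m R), seqM b m k := Finset.sum_nonneg fun i _ => (hc i).le
    have p2 : (R:ℝ) * ∑ k ∈ Finset.Ico (m R) n, b k ≤ ∑ k ∈ Finset.Ico (m R) n, seqM b m k := by
      rw [Finset.mul_sum]
      refine Finset.sum_le_sum fun k hk => ?_
      rw [hseq]
      refine mul_le_mul_of_nonneg_right ?_ (hb k).le
      exact_mod_cast hwR R k (Finset.mem_Ico.1 hk).1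
    linarith
  have e2 := hKn n hn3
  have hAp := psum_pos hA.2.1 hn3
  set An := ∑ k ∈ Finset.range n, a k
  rw [div_lt_iff₀ hε] at hn2
  rw [div_lt_iff₀ hε] at hR
  have e3 := mul_le_mul_of_nonneg_left hn1 hR0.le
  have e4 := mul_lt_mul_of_pos_left hn2 hR0
  have e5 := mul_lt_mul_of_pos_right hR hAp
  nlinarith

/-- For Waterman sequences `A`, `B` with `B` proper, the following are
equivalent: (a) the compact-embedding property of `ABV` into `BBV`; (b) `I_A ≤_K I_{B^M}`
for some increasing `M`; (c) `∑_{k≤n} b_k = o(∑_{k≤n} a_k)`. -/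
theorem stmt4 (a b : ℕ → ℝ) (hA : IsWaterman a) (hB : IsProperWaterman b) :
    (CompactEmbeddingABV a b ↔ PartialSumsLittleO a b) ∧
    ((∃ m : ℕ → ℕ, StrictMono m ∧ KatetovLE (IdealOf a) (IdealOf (seqM b m))) ↔
      PartialSumsLittleO a b) := by
  exact ⟨⟨a_imp_c hA hB.1, c_imp_a hA hB.1⟩,
    ⟨fun ⟨m, hm, h⟩ => b_imp_c hA hB hm h, c_imp_b hA hB.1⟩⟩
end

section
/- Let A = (a_n) and B = (b_n) be Waterman sequences. The following are equivalent: (a) ∑_{i=1}^n b_i = O(∑_{i=1}^n a_i), i.e. there is η > 0 with (∑_{i=1}^n b_i)/(∑_{i=1}^n a_i) ≤ η for all n ∈ ℕ; (b) I_A ≤_K I_B; (c) ABV ⊆ BBV. -/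
open Filter Set
open scoped ENNReal

lemma aux_sum_card {a : ℕ → ℝ} (ha : Antitone a) (F : Finset ℕ) :
    ∑ i ∈ F, a i ≤ ∑ i ∈ Finset.range F.card, a i := by
  induction F using Finset.induction_on_max with
  | empty => simp
  | insert m S h ih =>
    have hm : m ∉ S := fun hh => lt_irrefl _ (h m hh)
    have hc : S.card ≤ m := by
      have : S ⊆ Finset.range m := fun x hx => Finset.mem_range.2 (h x hx)
      simpa using Finset.card_le_card this
    rw [Finset.sum_insert hm, Finset.card_insert_of_notMem hm, Finset.sum_range_succ]
    linarith [ha hc]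

lemma aux_sum_le {a : ℕ → ℝ} (ha : Antitone a) (h0 : ∀ n, 0 ≤ a n) (F : Finset ℕ) (n : ℕ)
    (hn : F.card ≤ n) : ∑ i ∈ F, a i ≤ ∑ i ∈ Finset.range n, a i :=
  (aux_sum_card ha F).trans (Finset.sum_le_sum_of_subset_of_nonneg
    (Finset.range_mono hn) (fun i _ _ => h0 i))

lemma aux_abel {d c : ℕ → ℝ} (hc : Antitone c) 
    (hd : ∀ n, 0 ≤ ∑ i ∈ Finset.range n, d i) (N : ℕ) :
    c N * ∑ i ∈ Finset.range (N+1), d i ≤ ∑ i ∈ Finset.range (N+1), d i * c i := by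
  induction N with
  | zero => simp [mul_comm]
  | succ N ih =>
    rw [Finset.sum_range_succ, Finset.sum_range_succ (fun i => d i * c i)]
    have := mul_le_mul_of_nonneg_right (hc (Nat.le_succ N)) (hd (N+1))
    simp only [Nat.succ_eq_add_one] at this
    linarith

lemma aux_abel2 {a b c : ℕ → ℝ} (hc : Antitone c) (hc0 : ∀ n, 0 ≤ c n)
    (hd : ∀ n, ∑ i ∈ Finset.range n, b i ≤ ∑ i ∈ Finset.range n, a i) (N : ℕ) :
    ∑ i ∈ Finset.range N, b i * c i ≤ ∑ i ∈ Finset.range N, a i * c i := by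
  cases N with
  | zero => simp
  | succ N =>
    have h0 : ∀ n, 0 ≤ ∑ i ∈ Finset.range n, (a i - b i) := by
      intro n; rw [Finset.sum_sub_distrib]; linarith [hd n]
    have h := aux_abel hc h0 N
    have h2 := mul_nonneg (hc0 N) (h0 (N+1))
    have h3 := h2.trans h
    simp only [sub_mul] at h3
    rw [Finset.sum_sub_distrib] at h3
    linarith

/-- rearrangement inequality with an injection -/
lemma aux_rearr {a c : ℕ → ℝ} (ha : Antitone a) (ha0 : ∀ n, 0 ≤ a n) (hc : Antitone c)
    (hc0 : ∀ n, 0 ≤ c n) (S : Finset ℕ) (σ : ℕ → ℕ) (hσ : Set.InjOn σ S) (N : ℕ)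
    (hN : ∀ n ∈ S, σ n < N) :
    ∑ n ∈ S, a n * c (σ n) ≤ ∑ n ∈ Finset.range N, a n * c n := by
  have h1 : ∑ n ∈ S, a n * c (σ n) =
      ∑ k ∈ Finset.range N, (∑ n ∈ S with σ n = k, a n) * c k := by
    rw [← Finset.sum_fiberwise_of_maps_to (g := σ) (t := Finset.range N)
      (fun n hn => Finset.mem_range.2 (hN n hn))]
    refine Finset.sum_congr rfl fun k _ => ?_
    rw [Finset.sum_mul]
    refine Finset.sum_congr rfl fun n hn => ?_
    rw [(Finset.mem_filter.1 hn).2]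
  rw [h1]
  refine aux_abel2 hc hc0 (fun m => ?_) N
  have h2 : ∑ k ∈ Finset.range m, ∑ n ∈ S with σ n = k, a n = ∑ n ∈ S with σ n < m, a n := by
    rw [← Finset.sum_fiberwise_of_maps_to (g := σ) (t := Finset.range m) (s := {n ∈ S | σ n < m})
      (fun n hn => Finset.mem_range.2 (Finset.mem_filter.1 hn).2)]
    refine Finset.sum_congr rfl fun k hk => ?_
    refine Finset.sum_congr ?_ fun _ _ => rfl
    ext n
    have := Finset.mem_range.1 hk
    simp only [Finset.mem_filter]
    constructor
    · rintro ⟨h, rfl⟩; exact ⟨⟨h, this⟩, rfl⟩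
    · rintro ⟨⟨h, _⟩, h'⟩; exact ⟨h, h'⟩
  rw [h2]
  refine aux_sum_le ha ha0 _ _ ?_
  have := Finset.card_le_card_of_injOn (s := {n ∈ S | σ n < m}) (t := Finset.range m) σ
    (fun n hn => by simpa using (Finset.mem_filter.1 hn).2)
    (hσ.mono (by intro n hn; simpa using (Finset.mem_filter.1 hn).1))
  simpa using this

lemma aux_eVar_le {a : ℕ → ℝ} (ha0 : ∀ n, 0 ≤ a n) {x : ℝ → ℝ} {M : ℝ≥0∞}
    (h : ∀ s t : ℕ → ℝ, Nonoverlapping s t → ∀ N : ℕ,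
      ENNReal.ofReal (∑ n ∈ Finset.range N, a n * |x (t n) - x (s n)|) ≤ M) :
    eVar a x ≤ M := by
  refine iSup_le fun p => ENNReal.tsum_le_of_sum_range_le fun N => ?_
  rw [← ENNReal.ofReal_sum_of_nonneg (fun n _ => mul_nonneg (ha0 n) (abs_nonneg _))]
  exact h _ _ p.2 N

lemma aux_le_eVar {a : ℕ → ℝ} (ha0 : ∀ n, 0 ≤ a n) {x : ℝ → ℝ} 
    (s t : ℕ → ℝ) (h : Nonoverlapping s t) (N : ℕ) :
      ENNReal.ofReal (∑ n ∈ Finset.range N, a n * |x (t n) - x (s n)|) ≤ eVar a x := by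
  refine le_trans ?_ (le_iSup (fun p : {p : (ℕ → ℝ) × (ℕ → ℝ) // Nonoverlapping p.1 p.2} =>
    ∑' n, ENNReal.ofReal (a n * |x (p.1.2 n) - x (p.1.1 n)|)) ⟨(s, t), h⟩)
  rw [ENNReal.ofReal_sum_of_nonneg (fun n _ => mul_nonneg (ha0 n) (abs_nonneg _))]
  exact ENNReal.sum_le_tsum _

lemma aux_sum_pos {a : ℕ → ℝ} (ha : ∀ n, 0 < a n) (n : ℕ) (hn : n ≠ 0) :
    0 < ∑ i ∈ Finset.range n, a i :=
  Finset.sum_pos (fun i _ => ha i) (by simpa using hn)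

lemma aux_ratio {a b : ℕ → ℝ} (ha : ∀ n, 0 < a n) {η : ℝ}
    (h : ∀ n : ℕ, (∑ i ∈ Finset.range n, b i) / (∑ i ∈ Finset.range n, a i) ≤ η) (n : ℕ) :
    ∑ i ∈ Finset.range n, b i ≤ η * ∑ i ∈ Finset.range n, a i := by
  rcases eq_or_ne n 0 with rfl | hn
  · simp
  · exact (div_le_iff₀ (aux_sum_pos ha n hn)).1 (h n)

lemma aux_a_c {a b : ℕ → ℝ} (hA : IsWaterman a) (hB : IsWaterman b) {η : ℝ} (hη : 0 < η)
    (h : ∀ n : ℕ, (∑ i ∈ Finset.range n, b i) / (∑ i ∈ Finset.range n, a i) ≤ η)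
    (x : ℝ → ℝ) (hx : MemABV a x) : MemABV b x := by
  obtain ⟨ha, ha0, -⟩ := hA
  obtain ⟨hb, hb0, -⟩ := hB
  have hle : eVar b x ≤ ENNReal.ofReal η * eVar a x := by
    refine aux_eVar_le (fun n => (hb0 n).le) fun s t hst N => ?_
    let c : Fin N → ℝ := fun n => |x (t n) - x (s n)|
    let σ : Equiv.Perm (Fin N) := Tuple.sort (fun i => - c i)
    have hσ : Antitone (fun i => c (σ i)) := by
      intro i j hij
      have := Tuple.monotone_sort (fun i => - c i) hij
      simpa using this
    let s' : ℕ → ℝ := fun n => if h : n < N then s (σ ⟨n, h⟩) else 0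
    let t' : ℕ → ℝ := fun n => if h : n < N then t (σ ⟨n, h⟩) else 0
    let d : ℕ → ℝ := fun n => |x (t' n) - x (s' n)|
    have hd0 : ∀ n, 0 ≤ d n := fun n => abs_nonneg _
    have hdlt : ∀ n (h : n < N), d n = c (σ ⟨n, h⟩) := by
      intro n h
      simp [d, s', t', c, h]
    have hdge : ∀ n, ¬ n < N → d n = 0 := by
      intro n h
      simp [d, s', t', h]
    have hd : Antitone d := by
      intro i j hij
      by_cases hj : j < N
      · rw [hdlt j hj, hdlt i (by omega)]
        exact hσ (by simpa using hij)
      · rw [hdge j hj]; exact hd0 i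
    have hno : Nonoverlapping s' t' := by
      constructor
      · intro n
        by_cases hn : n < N
        · simpa [s', t', hn] using hst.1 _
        · simp [s', t', hn]
      · intro m n hmn
        by_cases hn : n < N
        · by_cases hm : m < N
          · simp only [s', t', hn, hm, dif_pos]
            apply hst.2
            intro h
            have := σ.injective (Fin.ext h)
            exact hmn (by simpa using this)
          · simp [s', t', hm]
        · simp [s', t', hn]
    let τ : ℕ → ℕ := fun n => if h : n < N then (σ.symm ⟨n, h⟩ : ℕ) else 0
    have h1 : ∑ n ∈ Finset.range N, b n * |x (t n) - x (s n)| ≤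
        ∑ n ∈ Finset.range N, b n * d n := by
      have := aux_rearr hb (fun n => (hb0 n).le) hd hd0 (Finset.range N) τ
        (by
          intro m hm n hn hmn
          have hm := Finset.mem_range.1 (Finset.mem_coe.1 hm)
          have hn := Finset.mem_range.1 (Finset.mem_coe.1 hn)
          simp only [τ, hm, hn, dif_pos] at hmn
          simpa using σ.symm.injective (Fin.ext hmn)) N
        (by
          intro n hn
          have hn := Finset.mem_range.1 hn
          simp only [τ, hn, dif_pos]
          exact Fin.is_lt _)
      refine le_trans (le_of_eq ?_) this
      refine Finset.sum_congr rfl fun n hn => ?_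
      have hn := Finset.mem_range.1 hn
      rw [hdlt (τ n) (by simp only [τ, hn, dif_pos]; exact Fin.is_lt _)]
      simp [τ, hn, c]
    have h2 : ∑ n ∈ Finset.range N, b n * d n ≤ ∑ n ∈ Finset.range N, (η * a n) * d n := by
      refine aux_abel2 hd hd0 (fun n => ?_) N
      rw [← Finset.mul_sum]
      exact aux_ratio ha0 h n
    have h3 : ∑ n ∈ Finset.range N, (η * a n) * d n = η * ∑ n ∈ Finset.range N, a n * d n := by
      rw [Finset.mul_sum]
      exact Finset.sum_congr rfl fun n _ => by ring
    calc _ ≤ ENNReal.ofReal (η * ∑ n ∈ Finset.range N, a n * d n) :=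
          ENNReal.ofReal_le_ofReal (by linarith)
      _ = ENNReal.ofReal η * ENNReal.ofReal (∑ n ∈ Finset.range N, a n * d n) :=
          ENNReal.ofReal_mul hη.le
      _ ≤ _ := by
          gcongr
          exact aux_le_eVar (fun n => (ha0 n).le) s' t' hno N
  exact lt_of_le_of_lt hle (ENNReal.mul_lt_top ENNReal.ofReal_lt_top hx)

lemma aux_exists_c {a b : ℕ → ℝ} (hA : IsWaterman a) (hB : IsWaterman b)
    (hn : ¬ ∃ η : ℝ, 0 < η ∧ ∀ n : ℕ,
        (∑ i ∈ Finset.range n, b i) / (∑ i ∈ Finset.range n, a i) ≤ η) :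
    ∃ c : ℕ → ℝ, Antitone c ∧ (∀ n, 0 ≤ c n) ∧
      (∀ N, ∑ k ∈ Finset.range N, a k * c k ≤ 2) ∧
      ∀ j : ℕ, ∃ N, (2:ℝ)^j ≤ ∑ k ∈ Finset.range N, b k * c k := by
  obtain ⟨ha, ha0, -⟩ := hA
  obtain ⟨hb, hb0, -⟩ := hB
  push Not at hn
  have hn' := fun j : ℕ => hn ((4:ℝ)^j) (by positivity)
  choose n hn using hn'
  have hn0 : ∀ j, n j ≠ 0 := by
    intro j h
    have := hn j
    rw [h] at this
    simp at this
    linarith [pow_pos (show (0:ℝ) < 4 by norm_num) j]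
  have hApos : ∀ j, 0 < ∑ i ∈ Finset.range (n j), a i := fun j => aux_sum_pos ha0 _ (hn0 j)
  have hAge : ∀ j, a 0 ≤ ∑ i ∈ Finset.range (n j), a i := fun j =>
    Finset.single_le_sum (f := a) (fun i _ => (ha0 i).le)
      (Finset.mem_range.2 (Nat.pos_of_ne_zero (hn0 j)))
  let g : ℕ → ℕ → ℝ := fun j k =>
    if k < n j then (1/2:ℝ)^j / ∑ i ∈ Finset.range (n j), a i else 0
  have hg0 : ∀ j k, 0 ≤ g j k := by
    intro j k
    simp only [g]
    split_ifs
    · have := hApos j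
      positivity
    · exact le_rfl
  have hgle : ∀ j k, g j k ≤ (1/2:ℝ)^j / a 0 := by
    intro j k
    have h0 := ha0 0
    simp only [g]
    split_ifs
    · exact div_le_div_of_nonneg_left (by positivity) h0 (hAge j)
    · positivity
  have hgs : ∀ k, Summable (fun j => g j k) := fun k =>
    Summable.of_nonneg_of_le (fun j => hg0 j k) (fun j => hgle j k)
      (summable_geometric_two.div_const _)
  refine ⟨fun k => ∑' j, g j k, ?_, fun k => tsum_nonneg fun j => hg0 j k, ?_, ?_⟩
  · intro k l hkl
    refine (hgs l).tsum_le_tsum (fun j => ?_) (hgs k)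
    by_cases hl : l < n j
    · have hk : k < n j := by omega
      simp [g, hl, hk]
    · have : g j l = 0 := by simp [g, hl]
      rw [this]; exact hg0 j k
  · intro N
    have h1 : ∑ k ∈ Finset.range N, a k * ∑' j, g j k =
        ∑' j, ∑ k ∈ Finset.range N, a k * g j k := by
      rw [Summable.tsum_finsetSum (fun k _ => (hgs k).mul_left _)]
      exact Finset.sum_congr rfl fun k _ => tsum_mul_left.symm
    rw [h1, ← tsum_geometric_two]
    refine Summable.tsum_le_tsum (fun j => ?_) (summable_sum fun k _ => (hgs k).mul_left _)
      summable_geometric_two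
    have h2 : ∑ k ∈ Finset.range N, a k * g j k ≤ ∑ k ∈ Finset.range (n j),
        a k * ((1/2:ℝ)^j / ∑ i ∈ Finset.range (n j), a i) := by
      have : ∀ k, a k * g j k = if k < n j then
          a k * ((1/2:ℝ)^j / ∑ i ∈ Finset.range (n j), a i) else 0 := by
        intro k; simp only [g]; split_ifs <;> simp
      simp only [this]
      rw [← Finset.sum_filter]
      refine Finset.sum_le_sum_of_subset_of_nonneg ?_ ?_
      · intro k hk
        exact Finset.mem_range.2 (Finset.mem_filter.1 hk).2
      · intro k _ _
        have := hApos j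
        have := ha0 k
        positivity
    rw [← Finset.sum_mul, mul_div_cancel₀ _ (hApos j).ne'] at h2
    exact h2
  · intro j
    refine ⟨n j, ?_⟩
    have h1 : ∑ k ∈ Finset.range (n j), b k * ((1/2:ℝ)^j / ∑ i ∈ Finset.range (n j), a i) ≤
        ∑ k ∈ Finset.range (n j), b k * ∑' j, g j k := by
      refine Finset.sum_le_sum fun k hk => ?_
      refine mul_le_mul_of_nonneg_left ?_ (hb0 k).le
      have h2 := (hgs k).le_tsum j (fun i _ => hg0 i k)
      simpa [g, Finset.mem_range.1 hk] using h2
    rw [← Finset.sum_mul] at h1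
    refine le_trans ?_ h1
    have h3 := (hn j).le
    have h4 : (2:ℝ)^j = (1/2:ℝ)^j * 4^j := by rw [← mul_pow]; norm_num
    rw [h4]
    calc _ ≤ (1/2:ℝ)^j * ((∑ i ∈ Finset.range (n j), b i) / ∑ i ∈ Finset.range (n j), a i) := by
          gcongr
      _ = _ := by ring

noncomputable def auxPt (n : ℕ) : ℝ := 1 / (2 * (n:ℝ) + 1)

lemma auxPt_inj : Function.Injective auxPt := by
  intro m n h
  unfold auxPt at h
  have h1 : (2 * (m:ℝ) + 1) = 2 * (n:ℝ) + 1 := by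
    have := congrArg (fun z : ℝ => z⁻¹) h
    simpa using this
  have : (m:ℝ) = n := by linarith
  exact_mod_cast this

/-- one-sided sums of the bump function -/
lemma aux_bump {a c : ℕ → ℝ} (ha : Antitone a) (ha0 : ∀ n, 0 ≤ a n) (hc : Antitone c)
    (hc0 : ∀ n, 0 ≤ c n) {M : ℝ} (hM : ∀ N, ∑ k ∈ Finset.range N, a k * c k ≤ M)
    (S : Finset ℕ) (u : ℕ → ℝ) (hu : Set.InjOn u S) :
    ∑ n ∈ S, a n * Function.extend auxPt c 0 (u n) ≤ M := by
  classical
  have h1 : ∑ n ∈ S, a n * Function.extend auxPt c 0 (u n) =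
      ∑ n ∈ S with (∃ k, auxPt k = u n), a n * Function.extend auxPt c 0 (u n) := by
    rw [Finset.sum_filter]
    refine Finset.sum_congr rfl fun n _ => ?_
    split_ifs with h
    · rfl
    · rw [Function.extend_apply' _ _ _ h]; simp
  let σ : ℕ → ℕ := fun n => if h : ∃ k, auxPt k = u n then h.choose else 0
  have hσ : ∀ n, (∃ k, auxPt k = u n) → auxPt (σ n) = u n := by
    intro n h
    simp only [σ, h, dif_pos]
    exact h.choose_spec
  have h2 : ∑ n ∈ S with (∃ k, auxPt k = u n), a n * Function.extend auxPt c 0 (u n) =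
      ∑ n ∈ S with (∃ k, auxPt k = u n), a n * c (σ n) := by
    refine Finset.sum_congr rfl fun n hn => ?_
    rw [← hσ n (Finset.mem_filter.1 hn).2, auxPt_inj.extend_apply]
  rw [h1, h2]
  let S' := {n ∈ S | ∃ k, auxPt k = u n}
  refine (aux_rearr ha ha0 hc hc0 S' σ ?_ (S'.sup σ + 1) ?_).trans (hM _)
  · intro m hm n hn hmn
    have hm := Finset.mem_filter.1 (Finset.mem_coe.1 hm)
    have hn := Finset.mem_filter.1 (Finset.mem_coe.1 hn)
    refine hu hm.1 hn.1 ?_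
    rw [← hσ m hm.2, ← hσ n hn.2, hmn]
  · intro n hn
    exact Nat.lt_succ_of_le (Finset.le_sup (f := σ) hn)

lemma aux_c_a {a b : ℕ → ℝ} (hA : IsWaterman a) (hB : IsWaterman b)
    (h : ∀ x : ℝ → ℝ, MemABV a x → MemABV b x) :
    ∃ η : ℝ, 0 < η ∧ ∀ n : ℕ,
        (∑ i ∈ Finset.range n, b i) / (∑ i ∈ Finset.range n, a i) ≤ η := by
  by_contra hn
  obtain ⟨c, hc, hc0, hac, hbc⟩ := aux_exists_c hA hB hn
  obtain ⟨ha, ha0, -⟩ := hA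
  obtain ⟨hb, hb0, -⟩ := hB
  set x : ℝ → ℝ := Function.extend auxPt c 0 with hxdef
  have hx0 : ∀ t, 0 ≤ x t := by
    intro t
    by_cases ht : ∃ k, auxPt k = t
    · obtain ⟨k, rfl⟩ := ht
      rw [hxdef, auxPt_inj.extend_apply]; exact hc0 k
    · rw [hxdef, Function.extend_apply' _ _ _ ht]; simp
  have hxa : MemABV a x := by
    refine lt_of_le_of_lt (b := ENNReal.ofReal 4) ?_ ENNReal.ofReal_lt_top
    refine aux_eVar_le (fun n => (ha0 n).le) fun s t hst N => ENNReal.ofReal_le_ofReal ?_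
    let S : Finset ℕ := {n ∈ Finset.range N | s n < t n}
    have hov : ∀ m ∈ S, ∀ n ∈ S, ∀ z, z ∈ Set.Ioo (s m) (t m) → z ∈ Set.Ioo (s n) (t n) →
        m = n := by
      intro m _ n _ z h1 h2
      by_contra hmn
      exact Set.disjoint_left.1 (hst.2 hmn) h1 h2
    have hs : Set.InjOn s S := by
      intro m hm n hn hmn
      have h1 := (Finset.mem_filter.1 (Finset.mem_coe.1 hm)).2
      have h2 := (Finset.mem_filter.1 (Finset.mem_coe.1 hn)).2
      obtain ⟨z, hz1, hz2⟩ := exists_between (lt_min h1 (hmn ▸ h2 : s m < t n))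
      exact hov m hm n hn z ⟨hz1, hz2.trans_le (min_le_left _ _)⟩
        ⟨hmn ▸ hz1, hz2.trans_le (min_le_right _ _)⟩
    have ht : Set.InjOn t S := by
      intro m hm n hn hmn
      have h1 := (Finset.mem_filter.1 (Finset.mem_coe.1 hm)).2
      have h2 := (Finset.mem_filter.1 (Finset.mem_coe.1 hn)).2
      obtain ⟨z, hz1, hz2⟩ := exists_between (max_lt h1 (hmn ▸ h2 : s n < t m))
      exact hov m hm n hn z ⟨(le_max_left _ _).trans_lt hz1, hz2⟩
        ⟨(le_max_right _ _).trans_lt hz1, hmn ▸ hz2⟩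
    have e1 := aux_bump ha (fun n => (ha0 n).le) hc hc0 hac S s hs
    have e2 := aux_bump ha (fun n => (ha0 n).le) hc hc0 hac S t ht
    rw [← hxdef] at e1 e2
    have e3 : ∑ n ∈ Finset.range N, a n * |x (t n) - x (s n)| =
        ∑ n ∈ S, a n * |x (t n) - x (s n)| := by
      rw [Finset.sum_filter]
      refine Finset.sum_congr rfl fun n _ => ?_
      split_ifs with h
      · rfl
      · have : s n = t n := le_antisymm (hst.1 n).2.1 (not_lt.1 h)
        simp [this]
    have e4 : ∑ n ∈ S, a n * |x (t n) - x (s n)| ≤ ∑ n ∈ S, (a n * x (t n) + a n * x (s n)) := by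
      refine Finset.sum_le_sum fun n _ => ?_
      rw [← mul_add]
      refine mul_le_mul_of_nonneg_left ?_ (ha0 n).le
      rw [abs_le]
      constructor <;> linarith [hx0 (t n), hx0 (s n)]
    rw [Finset.sum_add_distrib] at e4
    linarith
  have hxb := h x hxa
  let s : ℕ → ℝ := fun n => 1 / (2 * (n:ℝ) + 2)
  have hs : ∀ n, x (s n) = 0 := by
    intro n
    have : ¬ ∃ k, auxPt k = s n := by
      rintro ⟨k, hk⟩
      unfold auxPt at hk
      have h1 : (2 * (k:ℝ) + 1) = 2 * (n:ℝ) + 2 := by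
        have := congrArg (fun z : ℝ => z⁻¹) hk
        simpa [s] using this
      have h2 : 2 * k + 1 = 2 * n + 2 := by exact_mod_cast h1
      omega
    rw [hxdef, Function.extend_apply' _ _ _ this]; rfl
  have hlt : ∀ m n : ℕ, m < n → auxPt n ≤ s m := by
    intro m n hmn
    unfold auxPt
    refine one_div_le_one_div_of_le (by positivity) ?_
    have : (m:ℝ) + 1 ≤ n := by exact_mod_cast hmn
    linarith
  have hno : Nonoverlapping s auxPt := by
    constructor
    · intro n
      refine ⟨by simp only [s]; positivity, ?_, ?_⟩
      · unfold auxPt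
        exact one_div_le_one_div_of_le (by positivity) (by linarith)
      · unfold auxPt
        rw [div_le_one (by positivity)]
        have : (0:ℝ) ≤ n := by positivity
        linarith
    · intro m n hmn
      rw [Set.disjoint_left]
      rintro z ⟨h1, h2⟩ ⟨h3, h4⟩
      rcases lt_or_gt_of_ne hmn with h | h
      · linarith [hlt m n h]
      · linarith [hlt n m h]
  obtain ⟨j, hj⟩ := pow_unbounded_of_one_lt (eVar b x).toReal (by norm_num : (1:ℝ) < 2)
  obtain ⟨N, hN⟩ := hbc j
  have h5 := aux_le_eVar (x := x) (fun n => (hb0 n).le) s auxPt hno N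
  have h6 : ∑ n ∈ Finset.range N, b n * |x (auxPt n) - x (s n)| =
      ∑ n ∈ Finset.range N, b n * c n := by
    refine Finset.sum_congr rfl fun n _ => ?_
    rw [hs n, hxdef, auxPt_inj.extend_apply, sub_zero, abs_of_nonneg (hc0 n)]
  rw [h6, ENNReal.ofReal_le_iff_le_toReal hxb.ne] at h5
  linarith

noncomputable def auxMass (α : ℕ → ℝ≥0∞) (C : Set ℕ) : ℝ≥0∞ := ∑' k, C.indicator α k

lemma auxMass_mono (α : ℕ → ℝ≥0∞) {C D : Set ℕ} (h : C ⊆ D) : auxMass α C ≤ auxMass α D :=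
  ENNReal.tsum_le_tsum fun k => Set.indicator_le_indicator_of_subset h (fun _ => zero_le) k

lemma auxMass_union (α : ℕ → ℝ≥0∞) (C D : Set ℕ) :
    auxMass α (C ∪ D) ≤ auxMass α C + auxMass α D := by
  unfold auxMass
  rw [← ENNReal.tsum_add]
  refine ENNReal.tsum_le_tsum fun k => ?_
  by_cases h1 : k ∈ C <;> by_cases h2 : k ∈ D <;> simp [h1, h2]

lemma auxMass_iUnion (α : ℕ → ℝ≥0∞) (F : ℕ → Set ℕ) :
    auxMass α (⋃ j, F j) ≤ ∑' j, auxMass α (F j) := by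
  unfold auxMass
  rw [ENNReal.tsum_comm]
  refine ENNReal.tsum_le_tsum fun k => ?_
  by_cases h : k ∈ ⋃ j, F j
  · rw [Set.indicator_of_mem h]
    obtain ⟨j, hj⟩ := Set.mem_iUnion.1 h
    refine le_trans (le_of_eq ?_) (ENNReal.le_tsum j)
    rw [Set.indicator_of_mem hj]
  · rw [Set.indicator_of_notMem h]; exact zero_le

lemma auxMass_Iio (α : ℕ → ℝ≥0∞) (Z : Set ℕ) (m : ℕ) :
    auxMass α (Z ∩ Set.Iio m) = ∑ k ∈ Finset.range m, Z.indicator α k := by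
  unfold auxMass
  rw [tsum_eq_sum (s := Finset.range m)]
  · refine Finset.sum_congr rfl fun k hk => ?_
    have := Finset.mem_range.1 hk
    by_cases h : k ∈ Z <;> simp [h, this]
  · intro k hk
    have : ¬ k < m := by simpa using hk
    simp [this]

lemma auxMass_ideal {a : ℕ → ℝ} (ha : ∀ n, 0 ≤ a n) (C : Set ℕ) :
    C ∈ IdealOf a ↔ auxMass (fun n => ENNReal.ofReal (a n)) C ≠ ⊤ := by
  have h1 : C ∈ IdealOf a ↔ Summable (C.indicator a) :=
    summable_subtype_iff_indicator (f := a) (s := C)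
  have h2 : ∀ n, 0 ≤ C.indicator a n := fun n => Set.indicator_nonneg (fun i _ => ha i) n
  have h3 : auxMass (fun n => ENNReal.ofReal (a n)) C = ∑' n, ENNReal.ofReal (C.indicator a n) := by
    unfold auxMass
    refine tsum_congr fun n => ?_
    by_cases h : n ∈ C <;> simp [h]
  rw [h1, h3]
  constructor
  · exact fun h => h.tsum_ofReal_ne_top
  · intro h
    have := ENNReal.summable_toReal h
    simpa [ENNReal.toReal_ofReal, h2] using this

lemma auxMass_pre (β : ℕ → ℝ≥0∞) (f : ℕ → ℕ) (C : Set ℕ) :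
    auxMass β (f ⁻¹' C) = auxMass (fun k => auxMass β (f ⁻¹' {k})) C := by
  have : ∀ k, C.indicator (fun k => auxMass β (f ⁻¹' {k})) k =
      ∑' n, if k = f n then (f ⁻¹' C).indicator β n else 0 := by
    intro k
    by_cases hk : k ∈ C
    · rw [Set.indicator_of_mem hk]
      refine tsum_congr fun n => ?_
      by_cases h : k = f n
      · subst h; simp [hk]
      · have : ¬ f n = k := fun h' => h h'.symm
        simp [h, this]
    · rw [Set.indicator_of_notMem hk]
      symm
      rw [ENNReal.tsum_eq_zero]
      intro n
      by_cases h : k = f n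
      · subst h; simp [hk]
      · simp [h]
  unfold auxMass at this ⊢
  simp only [this]
  rw [ENNReal.tsum_comm]
  refine tsum_congr fun n => ?_
  rw [tsum_ite_eq]

lemma aux_key {α β : ℕ → ℝ≥0∞} (hα : Tendsto α atTop (nhds 0)) (hfin : ∀ k, α k ≠ ⊤)
    (h : ∀ C, auxMass α C ≠ ⊤ → auxMass β C ≠ ⊤) :
    ∃ j : ℕ, auxMass β {k | 2 ^ j * 2 ^ j * α k < β k} ≠ ⊤ := by
  by_contra hcon
  push Not at hcon
  have main : ∀ j : ℕ, ∃ F : Set ℕ, auxMass α F ≤ 2 * (2⁻¹) ^ j ∧ 2 ^ j ≤ auxMass β F := by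
    intro j
    set Z := {k | 2 ^ j * 2 ^ j * α k < β k} with hZ
    have hpos : (0 : ℝ≥0∞) < (2⁻¹) ^ j := by
      exact pos_iff_ne_zero.2 (pow_ne_zero _ (by simp))
    obtain ⟨N, hN⟩ := eventually_atTop.1 (hα.eventually (ge_mem_nhds hpos))
    have hZ' : auxMass β (Z ∩ Set.Ici N) = ⊤ := by
      by_contra hne
      have h1 : auxMass β (Set.univ ∩ Set.Iio N) ≠ ⊤ := by
        apply h
        rw [auxMass_Iio]
        exact (ENNReal.sum_lt_top.2 fun k _ => by simpa using (hfin k).lt_top).ne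
      have h2 : auxMass β Z ≤ auxMass β (Z ∩ Set.Ici N) + auxMass β (Set.univ ∩ Set.Iio N) := by
        refine le_trans (auxMass_mono β ?_) (auxMass_union _ _ _)
        intro k hk
        by_cases hkN : N ≤ k
        · exact Or.inl ⟨hk, hkN⟩
        · exact Or.inr ⟨trivial, not_le.1 hkN⟩
      rw [hcon j, top_le_iff, ENNReal.add_eq_top] at h2
      tauto
    set Y := Z ∩ Set.Ici N with hY
    have hex : ∃ m, 2 ^ j < ∑ k ∈ Finset.range m, Y.indicator β k := by
      rw [auxMass, ENNReal.tsum_eq_iSup_nat] at hZ'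
      apply lt_iSup_iff.1
      rw [hZ']
      exact ENNReal.pow_lt_top (by simp)
    classical
    have hm0 : Nat.find hex ≠ 0 := by
      intro h0
      have := Nat.find_spec hex
      rw [h0] at this
      simp at this
    obtain ⟨m, hm⟩ := Nat.exists_eq_succ_of_ne_zero hm0
    have hspec := Nat.find_spec hex
    have hmin := Nat.find_min hex (m := m) (by omega)
    rw [hm] at hspec
    push Not at hmin
    refine ⟨Y ∩ Set.Iio (m+1), ?_, ?_⟩
    · rw [auxMass_Iio, Finset.sum_range_succ, two_mul]
      refine add_le_add ?_ ?_
      · have h1 : 2 ^ j * 2 ^ j * ∑ k ∈ Finset.range m, Y.indicator α k ≤ 2 ^ j := by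
          refine le_trans ?_ hmin
          rw [Finset.mul_sum]
          refine Finset.sum_le_sum fun k _ => ?_
          by_cases hk : k ∈ Y
          · simpa [hk] using (show 2 ^ j * 2 ^ j * α k < β k from hk.1).le
          · simp [hk]
        have h2 : (2:ℝ≥0∞) ^ j * (2 ^ j * ∑ k ∈ Finset.range m, Y.indicator α k) ≤ 2 ^ j * 1 := by
          rw [mul_one, ← mul_assoc]; exact h1
        have h3 := (ENNReal.mul_le_mul_iff_right (by simp) (ENNReal.pow_ne_top (by simp))).1 h2
        rw [← ENNReal.inv_pow]
        rw [mul_comm] at h3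
        exact ENNReal.le_inv_iff_mul_le.2 h3
      · by_cases hk : m ∈ Y
        · rw [Set.indicator_of_mem hk]; exact hN m hk.2
        · simp [hk]
    · rw [auxMass_Iio]; exact hspec.le
  choose F hF1 hF2 using main
  have h1 : auxMass α (⋃ j, F j) ≠ ⊤ := by
    refine ne_top_of_le_ne_top ?_ ((auxMass_iUnion α F).trans (ENNReal.tsum_le_tsum hF1))
    rw [ENNReal.tsum_mul_left, ENNReal.tsum_geometric]
    simp [ENNReal.mul_eq_top]
  have h2 := h _ h1
  obtain ⟨j, hj⟩ := pow_unbounded_of_one_lt (auxMass β (⋃ j, F j)).toReal (by norm_num : (1:ℝ) < 2)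
  have h3 : (2:ℝ≥0∞)^j ≤ auxMass β (⋃ j, F j) :=
    (hF2 j).trans (auxMass_mono β (Set.subset_iUnion F j))
  have h4 := ENNReal.toReal_mono h2 h3
  simp at h4
  linarith

lemma aux_b_a {a b : ℕ → ℝ} (hA : IsWaterman a) (hB : IsWaterman b)
    (h : KatetovLE (IdealOf a) (IdealOf b)) :
    ∃ η : ℝ, 0 < η ∧ ∀ n : ℕ,
        (∑ i ∈ Finset.range n, b i) / (∑ i ∈ Finset.range n, a i) ≤ η := by
  obtain ⟨ha, ha0, -⟩ := hA
  obtain ⟨hb, hb0, -⟩ := hB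
  have hbdd : BddBelow (Set.range a) := ⟨0, by rintro _ ⟨n, rfl⟩; exact (ha0 n).le⟩
  have hlim := tendsto_atTop_ciInf ha hbdd
  have hinf : 0 ≤ ⨅ n, a n := le_ciInf fun n => (ha0 n).le
  suffices hs : ∃ η : ℝ, 0 < η ∧ ∀ n : ℕ, n ≠ 0 →
      ∑ i ∈ Finset.range n, b i ≤ η * ∑ i ∈ Finset.range n, a i by
    obtain ⟨η, hη, hs⟩ := hs
    refine ⟨η, hη, fun n => ?_⟩
    rcases eq_or_ne n 0 with rfl | hn
    · simpa using hη.le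
    · exact (div_le_iff₀ (aux_sum_pos ha0 n hn)).2 (hs n hn)
  rcases hinf.eq_or_lt with h0 | hpos
  · rw [← h0] at hlim
    obtain ⟨f, hf⟩ := h
    let α : ℕ → ℝ≥0∞ := fun n => ENNReal.ofReal (a n)
    let b' : ℕ → ℝ≥0∞ := fun n => ENNReal.ofReal (b n)
    let β : ℕ → ℝ≥0∞ := fun k => auxMass b' (f ⁻¹' {k})
    have hpre : ∀ C, auxMass b' (f ⁻¹' C) = auxMass β C := auxMass_pre b' f
    have hα : Tendsto α atTop (nhds 0) := by
      have := ENNReal.tendsto_ofReal hlim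
      simpa using this
    obtain ⟨j, hj⟩ := aux_key (α := α) (β := β) hα (fun k => ENNReal.ofReal_ne_top) (by
      intro C hC
      rw [← hpre]
      exact (auxMass_ideal (fun n => (hb0 n).le) _).1
        (hf C ((auxMass_ideal (fun n => (ha0 n).le) _).2 hC)))
    set Z := {k | 2 ^ j * 2 ^ j * α k < β k} with hZ
    rw [← hpre] at hj
    set M := auxMass b' (f ⁻¹' Z) with hM
    have key : ∀ n, ∑ i ∈ Finset.range n, b' i ≤ M + 2^j*2^j * ∑ i ∈ Finset.range n, α i := by
      intro n
      have e1 : ∑ i ∈ Finset.range n, b' i = ∑ i ∈ Finset.range n, (f ⁻¹' Z).indicator b' i +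
          ∑ i ∈ Finset.range n, (f ⁻¹' Zᶜ).indicator b' i := by
        rw [← Finset.sum_add_distrib]
        refine Finset.sum_congr rfl fun i _ => ?_
        by_cases hi : f i ∈ Z <;> simp [hi]
      rw [e1]
      refine add_le_add (ENNReal.sum_le_tsum _) ?_
      classical
      rw [← Finset.sum_fiberwise_of_maps_to (g := f) (t := (Finset.range n).image f)
        (fun i hi => Finset.mem_image_of_mem f hi)]
      have e2 : ∀ k, ∑ i ∈ Finset.range n with f i = k, (f ⁻¹' Zᶜ).indicator b' i ≤
          2^j*2^j * α k := by
        intro k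
        by_cases hk : k ∈ Z
        · refine le_trans (le_of_eq ?_) zero_le
          refine Finset.sum_eq_zero fun i hi => ?_
          have := (Finset.mem_filter.1 hi).2
          simp [this, hk]
        · refine le_trans ?_ (not_lt.1 hk)
          refine le_trans ?_ (ENNReal.sum_le_tsum {i ∈ Finset.range n | f i = k})
          refine Finset.sum_le_sum fun i hi => ?_
          have := (Finset.mem_filter.1 hi).2
          simp [this, hk]
      refine (Finset.sum_le_sum fun k _ => e2 k).trans ?_
      rw [← Finset.mul_sum]
      refine mul_le_mul' le_rfl ?_
      simp only [α]
      rw [← ENNReal.ofReal_sum_of_nonneg (fun i _ => (ha0 i).le),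
        ← ENNReal.ofReal_sum_of_nonneg (fun i _ => (ha0 i).le)]
      refine ENNReal.ofReal_le_ofReal (aux_sum_le ha (fun i => (ha0 i).le) _ _ ?_)
      simpa using Finset.card_image_le (s := Finset.range n) (f := f)
    refine ⟨M.toReal / a 0 + 2^j*2^j, ?_, ?_⟩
    · have := ha0 0
      have := ENNReal.toReal_nonneg (a := M)
      positivity
    · intro n hn
      have k1 := key n
      simp only [α, b'] at k1
      rw [← ENNReal.ofReal_sum_of_nonneg (fun i _ => (ha0 i).le),
        ← ENNReal.ofReal_sum_of_nonneg (fun i _ => (hb0 i).le)] at k1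
      have hne : (2:ℝ≥0∞)^j*2^j * ENNReal.ofReal (∑ i ∈ Finset.range n, a i) ≠ ⊤ :=
        ENNReal.mul_ne_top (ENNReal.mul_ne_top (ENNReal.pow_ne_top (by simp))
          (ENNReal.pow_ne_top (by simp))) ENNReal.ofReal_ne_top
      have k2 := ENNReal.toReal_mono (ENNReal.add_ne_top.2 ⟨hj, hne⟩) k1
      rw [ENNReal.toReal_add hj hne,
        ENNReal.toReal_ofReal (Finset.sum_nonneg fun i _ => (hb0 i).le), ENNReal.toReal_mul,
        ENNReal.toReal_ofReal (Finset.sum_nonneg fun i _ => (ha0 i).le)] at k2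
      simp only [ENNReal.toReal_mul, ENNReal.toReal_pow, ENNReal.toReal_ofNat] at k2
      have hge : a 0 ≤ ∑ i ∈ Finset.range n, a i :=
        Finset.single_le_sum (f := a) (fun i _ => (ha0 i).le)
          (Finset.mem_range.2 (Nat.pos_of_ne_zero hn))
      have k3 : M.toReal ≤ M.toReal / a 0 * ∑ i ∈ Finset.range n, a i := by
        calc M.toReal = M.toReal / a 0 * a 0 := by rw [div_mul_cancel₀ _ (ha0 0).ne']
          _ ≤ _ := mul_le_mul_of_nonneg_left hge
            (div_nonneg ENNReal.toReal_nonneg (ha0 0).le)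
      rw [add_mul]
      linarith
  · refine ⟨b 0 / ⨅ n, a n, div_pos (hb0 0) hpos, fun n _ => ?_⟩
    rw [Finset.mul_sum]
    refine Finset.sum_le_sum fun i _ => ?_
    calc b i ≤ b 0 := hb (Nat.zero_le i)
      _ = b 0 / (⨅ n, a n) * ⨅ n, a n := by rw [div_mul_cancel₀ _ hpos.ne']
      _ ≤ _ := mul_le_mul_of_nonneg_left (ciInf_le hbdd i) (div_pos (hb0 0) hpos).le

lemma aux_a_b {a b : ℕ → ℝ} (hA : IsWaterman a) (hB : IsWaterman b) {η : ℝ} (hη : 0 < η)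
    (h : ∀ n : ℕ, (∑ i ∈ Finset.range n, b i) / (∑ i ∈ Finset.range n, a i) ≤ η) :
    KatetovLE (IdealOf a) (IdealOf b) := by
  obtain ⟨ha, ha0, hadiv⟩ := hA
  obtain ⟨hb, hb0, -⟩ := hB
  have h := aux_ratio ha0 h
  have htend := (not_summable_iff_tendsto_nat_atTop_of_nonneg (fun n => (ha0 n).le)).1 hadiv
  have hex : ∀ n, ∃ k, ∑ i ∈ Finset.range n, b i < 2 * η * ∑ i ∈ Finset.range (k+1), a i := by
    intro n
    obtain ⟨k, hk⟩ := ((tendsto_add_atTop_iff_nat 1).2 htend).eventually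
      (eventually_gt_atTop ((∑ i ∈ Finset.range n, b i) / (2 * η))) |>.exists
    refine ⟨k, ?_⟩
    rw [div_lt_iff₀ (by positivity)] at hk
    linarith
  classical
  let f : ℕ → ℕ := fun n => Nat.find (hex n)
  have hf1 : ∀ n, ∑ i ∈ Finset.range n, b i < 2 * η * ∑ i ∈ Finset.range (f n + 1), a i :=
    fun n => Nat.find_spec (hex n)
  have hf2 : ∀ n, 2 * η * ∑ i ∈ Finset.range (f n), a i ≤ ∑ i ∈ Finset.range n, b i := by
    intro n
    rcases Nat.eq_zero_or_pos (f n) with h0 | h0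
    · rw [h0]
      simpa using Finset.sum_nonneg fun i _ => (hb0 i).le
    · have := Nat.find_min (hex n) (m := f n - 1) (by show f n - 1 < f n; omega)
      rw [Nat.sub_add_cancel h0] at this
      exact not_lt.1 this
  -- the last term is bounded
  have hlast : ∀ n, b n ≤ 2 * η * a (f n) := by
    intro n
    rcases Nat.eq_zero_or_pos n with rfl | hn
    · have h1 : f 0 = 0 := by
        have := hf2 0
        by_contra hne
        have h2 := aux_sum_pos ha0 (f 0) hne
        have : 0 < 2 * η * ∑ i ∈ Finset.range (f 0), a i := by positivity
        simp at *
        linarith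
      rw [h1]
      have := h 1
      simp at this
      have := ha0 0
      nlinarith
    · have hnb : n * b n ≤ ∑ i ∈ Finset.range n, b i := by
        have := Finset.card_nsmul_le_sum (Finset.range n) b (b n)
          (fun i hi => hb (Finset.mem_range.1 hi).le)
        simpa using this
      have hAn : ∑ i ∈ Finset.range n, a i ≤ ∑ i ∈ Finset.range (f n), a i + n * a (f n) := by
        have h1 : ∑ i ∈ Finset.range n, a i ≤ ∑ i ∈ Finset.range (f n + n), a i :=
          Finset.sum_le_sum_of_subset_of_nonneg (Finset.range_mono (by omega))
            (fun i _ _ => (ha0 i).le)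
        rw [Finset.sum_range_add] at h1
        have h2 : ∑ i ∈ Finset.range n, a (f n + i) ≤ n * a (f n) := by
          have := Finset.sum_le_card_nsmul (Finset.range n) (fun i => a (f n + i)) (a (f n))
            (fun i _ => ha (Nat.le_add_right _ _))
          simpa using this
        linarith
      have h3 := h n
      have h4 := hf2 n
      have h5 := mul_le_mul_of_nonneg_left hAn hη.le
      have hn' : (0:ℝ) < n := by exact_mod_cast hn
      have h6 : (n:ℝ) * b n ≤ n * (2 * η * a (f n)) := by nlinarith
      exact le_of_mul_le_mul_left h6 hn'
  have hfin : ∀ k N, ∑ i ∈ Finset.range N with f i = k, b i ≤ 4 * η * a k := by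
    intro k N
    set S := {i ∈ Finset.range N | f i = k} with hS
    rcases S.eq_empty_or_nonempty with h0 | hne
    · rw [h0]
      have := ha0 k
      simp; positivity
    · set p := S.min' hne
      set q := S.max' hne
      have hp : f p = k := (Finset.mem_filter.1 (S.min'_mem hne)).2
      have hq : f q = k := (Finset.mem_filter.1 (S.max'_mem hne)).2
      have hpq : p ≤ q := S.min'_le_max' hne
      have h1 : ∑ i ∈ S, b i ≤ ∑ i ∈ Finset.Ico p (q+1), b i := by
        refine Finset.sum_le_sum_of_subset_of_nonneg ?_ (fun i _ _ => (hb0 i).le)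
        intro i hi
        exact Finset.mem_Ico.2 ⟨S.min'_le i hi, Nat.lt_succ_of_le (S.le_max' i hi)⟩
      rw [Finset.sum_Ico_eq_sub _ (by omega), Finset.sum_range_succ] at h1
      have h2 := hf1 q
      have h3 := hf2 p
      have h4 := hlast q
      rw [hq] at h2 h4
      rw [hp] at h3
      rw [Finset.sum_range_succ] at h2
      linarith
  refine ⟨f, fun C hC => ?_⟩
  rw [auxMass_ideal (fun n => (ha0 n).le)] at hC
  rw [auxMass_ideal (fun n => (hb0 n).le), auxMass_pre]
  have hle : ∀ k, auxMass (fun n => ENNReal.ofReal (b n)) (f ⁻¹' {k}) ≤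
      ENNReal.ofReal (4 * η) * ENNReal.ofReal (a k) := by
    intro k
    refine ENNReal.tsum_le_of_sum_range_le fun N => ?_
    rw [← ENNReal.ofReal_mul (by positivity)]
    refine le_trans (le_of_eq ?_) (ENNReal.ofReal_le_ofReal (hfin k N))
    rw [ENNReal.ofReal_sum_of_nonneg (fun i _ => (hb0 i).le), Finset.sum_filter]
    refine Finset.sum_congr rfl fun i _ => ?_
    by_cases hi : f i = k <;> simp [hi]
  refine ne_top_of_le_ne_top (ENNReal.mul_ne_top (ENNReal.ofReal_ne_top (r := 4 * η)) hC) ?_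
  unfold auxMass at hle ⊢
  rw [← ENNReal.tsum_mul_left]
  refine ENNReal.tsum_le_tsum fun k => ?_
  by_cases hk : k ∈ C
  · simpa only [Set.indicator_of_mem hk] using hle k
  · simp [hk]

/-- For Waterman sequences `A`, `B`, the following are equivalent:
(a) `∑_{k≤n} b_k = O(∑_{k≤n} a_k)`; (b) `I_A ≤_K I_B`; (c) `ABV ⊆ BBV`. -/
theorem stmt9 (a b : ℕ → ℝ) (hA : IsWaterman a) (hB : IsWaterman b) :
    ((∃ η : ℝ, 0 < η ∧ ∀ n : ℕ,
        (∑ i ∈ Finset.range n, b i) / (∑ i ∈ Finset.range n, a i) ≤ η) ↔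
      KatetovLE (IdealOf a) (IdealOf b)) ∧
    (KatetovLE (IdealOf a) (IdealOf b) ↔ ∀ x : ℝ → ℝ, MemABV a x → MemABV b x) := by
  have hac : (∃ η : ℝ, 0 < η ∧ ∀ n : ℕ,
        (∑ i ∈ Finset.range n, b i) / (∑ i ∈ Finset.range n, a i) ≤ η) ↔
      ∀ x : ℝ → ℝ, MemABV a x → MemABV b x :=
    ⟨fun ⟨_, hη, h⟩ => aux_a_c hA hB hη h, aux_c_a hA hB⟩
  have hab : (∃ η : ℝ, 0 < η ∧ ∀ n : ℕ,
        (∑ i ∈ Finset.range n, b i) / (∑ i ∈ Finset.range n, a i) ≤ η) ↔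
      KatetovLE (IdealOf a) (IdealOf b) :=
    ⟨fun ⟨_, hη, h⟩ => aux_a_b hA hB hη h, aux_b_a hA hB⟩
  exact ⟨hab, hab.symm.trans hac⟩
end
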